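/- Let K ∈ ℝ, N ∈ [1,∞), let (X,d,m) be a CD*(K,N) metric measure space having the good transport property (GT), let mu, nu ∈ P2(X) have bounded supports, assume mu <= C*m for some constant C > 0, and let pi ∈ OptGeo(mu,nu) be the unique optimal geodesic plan from mu to nu. Let D := diam( supp(mu) ∪ supp(nu) ). Then for every t ∈ [0,1) one has (e_t)#pi <= C(t)*m, where C(t) := C * sup{ sigma^{(1-t)}_{K,N}(theta)^{-N} : 0 <= theta <= D } is a finite constant depending only on C, t, K, N and D. -/

import Mathlib

open MeasureTheory Metric Set unitInterval ENNReal NNReal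

noncomputable section

variable {X : Type*} [MetricSpace X]

/-- A constant speed minimizing geodesic parametrized on `[0,1]`. -/
def IsUnitGeodesic (γ : C(unitInterval, X)) : Prop :=
  ∀ s t : unitInterval, dist (γ s) (γ t) = |(s : ℝ) - (t : ℝ)| * dist (γ 0) (γ 1)

/-- The space of constant speed minimizing geodesics, with the sup distance. -/
def Geo (X : Type*) [MetricSpace X] : Type _ :=
  { γ : C(unitInterval, X) // IsUnitGeodesic γ }

instance : MetricSpace (Geo X) := Subtype.metricSpace
instance : MeasurableSpace (Geo X) := borel _
instance : BorelSpace (Geo X) := ⟨rfl⟩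

/-- Evaluation map `e_t`. -/
def eval (t : unitInterval) (γ : Geo X) : X := γ.1 t

/-- `(X,d)` is a geodesic space: any two points are joined by a geodesic. -/
def IsGeodesicSpace (X : Type*) [MetricSpace X] : Prop :=
  ∀ x y : X, ∃ γ : Geo X, eval 0 γ = x ∧ eval 1 γ = y

/-- The (topological) support of a measure. -/
def measSupport {Y : Type*} [TopologicalSpace Y] [MeasurableSpace Y] (μ : Measure Y) : Set Y :=
  {y | ∀ U ∈ nhds y, 0 < μ U}

variable [MeasurableSpace X]

/-- Finite second moment. -/
def HasFiniteSecondMoment (μ : Measure X) : Prop :=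
  ∃ x₀ : X, ∫⁻ x, ENNReal.ofReal (dist x x₀ ^ 2) ∂μ ≠ ⊤

/-- The transport cost of a plan on the space of geodesics. -/
def transportCost (π : Measure (Geo X)) : ℝ≥0∞ :=
  ∫⁻ γ, ENNReal.ofReal (dist (eval 0 γ) (eval 1 γ) ^ 2) ∂π

/-- `π ∈ OptGeo(μ,ν)`: an optimal geodesic plan from `μ` to `ν`. -/
def IsOptGeo (μ ν : Measure X) (π : Measure (Geo X)) : Prop :=
  IsProbabilityMeasure π ∧ π.map (eval 0) = μ ∧ π.map (eval 1) = ν ∧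
    ∀ π' : Measure (Geo X), IsProbabilityMeasure π' →
      π'.map (eval 0) = μ → π'.map (eval 1) = ν →
      transportCost π ≤ transportCost π'

/-- The distortion coefficients `σ_{K,N}^{(t)}(θ)`. -/
def sigmaCoeff (K N t θ : ℝ) : ℝ≥0∞ :=
  if N * Real.pi ^ 2 ≤ K * θ ^ 2 then ⊤
  else if 0 < K * θ ^ 2 then
    ENNReal.ofReal (Real.sin (t * θ * Real.sqrt (K / N)) / Real.sin (θ * Real.sqrt (K / N)))
  else if K * θ ^ 2 = 0 then ENNReal.ofReal t
  else ENNReal.ofReal (Real.sinh (t * θ * Real.sqrt (-K / N)) / Real.sinh (θ * Real.sqrt (-K / N)))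

/-- The distortion coefficients `τ_{K,N}^{(t)}(θ)`. -/
def tauCoeff (K N t θ : ℝ) : ℝ≥0∞ :=
  if N = 1 then
    (if K ≤ 0 then ENNReal.ofReal t else if θ = 0 then ENNReal.ofReal t else ⊤)
  else ENNReal.ofReal t ^ (1 / N) * sigmaCoeff K (N - 1) t θ ^ ((N - 1) / N)

/-- The (reduced) curvature dimension condition `CD*(K,N)`. -/
def IsCDStar (K N : ℝ) (m : Measure X) : Prop :=
  ∀ μ₀ μ₁ : Measure X, IsProbabilityMeasure μ₀ → IsProbabilityMeasure μ₁ →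
    (∃ s : Set X, Bornology.IsBounded s ∧ μ₀ sᶜ = 0 ∧ μ₁ sᶜ = 0) →
    ∃ π : Measure (Geo X), IsOptGeo μ₀ μ₁ π ∧
      ∀ t : unitInterval, ∀ N' : ℝ, N ≤ N' →
        ∫⁻ γ, (sigmaCoeff K N' (1 - (t : ℝ)) (dist (eval 0 γ) (eval 1 γ)) *
                 ((π.map (eval 0)).rnDeriv m (eval 0 γ)) ^ (-(1 / N')) +
               sigmaCoeff K N' (t : ℝ) (dist (eval 0 γ) (eval 1 γ)) *
                 ((π.map (eval 1)).rnDeriv m (eval 1 γ)) ^ (-(1 / N'))) ∂π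
          ≤ ∫⁻ x, ((π.map (eval t)).rnDeriv m x) ^ (1 - 1 / N') ∂m

/-- The good transport property (GT): between absolutely continuous measures in `P₂(X)` there is
a unique optimal geodesic plan, and it is induced by a map from every intermediate time. -/
def GoodTransport (m : Measure X) : Prop :=
  ∀ μ ν : Measure X, IsProbabilityMeasure μ → IsProbabilityMeasure ν →
    HasFiniteSecondMoment μ → HasFiniteSecondMoment ν → μ ≪ m → ν ≪ m →
    (∃! π : Measure (Geo X), IsOptGeo μ ν π) ∧
    ∀ π : Measure (Geo X), IsOptGeo μ ν π → ∀ t : unitInterval,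
      ∃ T : X → Geo X, Measurable T ∧ π = (π.map (eval t)).map T

/-- `c`-concavity (with `c = d²/2`) for functions with values in `ℝ ∪ {-∞}`. -/
def cConcave (φ : X → EReal) : Prop :=
  (∃ x, φ x ≠ ⊥) ∧ (∀ x, φ x ≠ ⊤) ∧
    ∃ ψ : X → EReal, (∀ y, ψ y ≠ ⊤) ∧
      ∀ x, φ x = ⨅ y, ((dist x y ^ 2 / 2 : ℝ) : EReal) - ψ y

/-- The `c`-transform `φᶜ`. -/
def cTransform (φ : X → EReal) : X → EReal :=
  fun y => ⨅ x, ((dist x y ^ 2 / 2 : ℝ) : EReal) - φ x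

/-- The `c`-superdifferential `∂ᶜφ`. -/
def cSuperdiff (φ : X → EReal) : Set (X × X) :=
  {p | φ p.1 + cTransform φ p.2 = ((dist p.1 p.2 ^ 2 / 2 : ℝ) : EReal)}

/-- Kantorovich potential from `μ` to `ν`. -/
def IsKantorovichPotential (μ ν : Measure X) (φ : X → EReal) : Prop :=
  cConcave φ ∧ ∀ π : Measure (Geo X), IsOptGeo μ ν π →
    measSupport (π.map (fun γ => (eval 0 γ, eval 1 γ))) ⊆ cSuperdiff φ

set_option linter.unusedSectionVars false

open Filter Topology in
lemma sinh_two_bound {τ x : ℝ} (hτ0 : 0 ≤ τ) (hτ1 : τ ≤ 1) (hx : 0 ≤ x) :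
    τ * Real.cosh (τ * x) * Real.sinh x - Real.sinh (τ * x) * Real.cosh x ≤ 0 := by
  set h : ℝ → ℝ := fun x => τ * Real.cosh (τ * x) * Real.sinh x - Real.sinh (τ * x) * Real.cosh x
    with hh
  have hd : ∀ y, HasDerivAt h ((τ ^ 2 - 1) * (Real.sinh (τ * y) * Real.sinh y)) y := by
    intro y
    have h1 : HasDerivAt (fun y => τ * y) τ y := by simpa using (hasDerivAt_id y).const_mul τ
    have h2 := ((h1.cosh.const_mul τ).mul (Real.hasDerivAt_sinh y)).sub
      (h1.sinh.mul (Real.hasDerivAt_cosh y))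
    exact h2.congr_deriv (by ring)
  have hanti : AntitoneOn h (Ici 0) := by
    apply antitoneOn_of_deriv_nonpos (convex_Ici 0)
    · exact fun y _ => (hd y).continuousAt.continuousWithinAt
    · exact fun y _ => (hd y).differentiableAt.differentiableWithinAt
    · intro y hy
      rw [interior_Ici] at hy
      have hy0 : 0 < y := hy
      rw [(hd y).deriv]
      have : 0 ≤ Real.sinh (τ * y) * Real.sinh y :=
        mul_nonneg (Real.sinh_nonneg_iff.2 (by positivity)) (Real.sinh_nonneg_iff.2 hy0.le)
      exact mul_nonpos_of_nonpos_of_nonneg (by nlinarith) this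
  have := hanti (mem_Ici.2 le_rfl) (mem_Ici.2 hx) hx
  simpa [hh] using this

lemma sinh_ratio_anti {τ x y : ℝ} (hτ0 : 0 ≤ τ) (hτ1 : τ ≤ 1) (hx : 0 < x) (hxy : x ≤ y) :
    Real.sinh (τ * y) / Real.sinh y ≤ Real.sinh (τ * x) / Real.sinh x := by
  set h : ℝ → ℝ := fun x => Real.sinh (τ * x) / Real.sinh x with hh
  have hd : ∀ y, 0 < y → HasDerivAt h ((τ * Real.cosh (τ * y) * Real.sinh y -
      Real.sinh (τ * y) * Real.cosh y) / Real.sinh y ^ 2) y := by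
    intro y hy
    have h1 : HasDerivAt (fun y => τ * y) τ y := by simpa using (hasDerivAt_id y).const_mul τ
    have h2 := h1.sinh.div (Real.hasDerivAt_sinh y) (Real.sinh_pos_iff.2 hy).ne'
    exact h2.congr_deriv (by ring)
  have hanti : AntitoneOn h (Ioi 0) := by
    apply antitoneOn_of_deriv_nonpos (convex_Ioi 0)
    · exact fun y hy => (hd y hy).continuousAt.continuousWithinAt
    · rw [interior_Ioi]
      exact fun y hy => (hd y hy).differentiableAt.differentiableWithinAt
    · intro y hy
      rw [interior_Ioi] at hy
      have hy0 : 0 < y := hy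
      rw [(hd y hy0).deriv]
      exact div_nonpos_of_nonpos_of_nonneg (sinh_two_bound hτ0 hτ1 hy0.le) (sq_nonneg _)
  exact hanti hx (hx.trans_le hxy) hxy

lemma sinh_mul_le' {τ x : ℝ} (hτ0 : 0 ≤ τ) (hτ1 : τ ≤ 1) (hx : 0 ≤ x) :
    Real.sinh (τ * x) ≤ τ * Real.sinh x := by
  set h : ℝ → ℝ := fun x => Real.sinh (τ * x) - τ * Real.sinh x with hh
  have hd : ∀ y, HasDerivAt h (τ * Real.cosh (τ * y) - τ * Real.cosh y) y := by
    intro y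
    have h1 : HasDerivAt (fun y => τ * y) τ y := by simpa using (hasDerivAt_id y).const_mul τ
    have h2 := h1.sinh.sub ((Real.hasDerivAt_sinh y).const_mul τ)
    exact h2.congr_deriv (by ring)
  have hanti : AntitoneOn h (Ici 0) := by
    apply antitoneOn_of_deriv_nonpos (convex_Ici 0)
    · exact fun y _ => (hd y).continuousAt.continuousWithinAt
    · exact fun y _ => (hd y).differentiableAt.differentiableWithinAt
    · intro y hy
      rw [interior_Ici] at hy
      have hy0 : 0 < y := hy
      rw [(hd y).deriv]
      have : Real.cosh (τ * y) ≤ Real.cosh y := by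
        rw [Real.cosh_le_cosh, abs_of_nonneg (by positivity), abs_of_nonneg hy0.le]
        nlinarith
      nlinarith
  have := hanti (mem_Ici.2 le_rfl) (mem_Ici.2 hx) hx
  simp [hh] at this
  linarith

/-- explicit lower bound of the distortion coefficients on `[0,D]`. -/
def sigLow (K N τ D : ℝ) : ℝ :=
  if 0 ≤ K then τ else if D = 0 then τ else
    Real.sinh (τ * (D * Real.sqrt (-K / N))) / Real.sinh (D * Real.sqrt (-K / N))

lemma sigLow_eq {K N τ D : ℝ} (hN : 1 ≤ N) :
    ENNReal.ofReal (sigLow K N τ D) = sigmaCoeff K N τ (if 0 ≤ K then 0 else D) := by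
  have hp : 0 < N * Real.pi ^ 2 := by positivity
  unfold sigLow sigmaCoeff
  by_cases hK : 0 ≤ K
  · simp [hK, hp]
  · have hK' : K < 0 := not_le.1 hK
    by_cases hD : D = 0
    · simp [hK, hD, hp]
    · have h1 : K * D ^ 2 < 0 := mul_neg_of_neg_of_pos hK' (by positivity)
      have h2 : ¬ (N * Real.pi ^ 2 ≤ K * D ^ 2) := by linarith
      rw [if_neg hK, if_neg hK, if_neg hD, if_neg h2, if_neg (by linarith), if_neg h1.ne, mul_assoc]

lemma sigLow_le {K N τ D θ : ℝ} (hN : 1 ≤ N) (hτ0 : 0 ≤ τ) (hτ1 : τ ≤ 1) (hθ0 : 0 ≤ θ)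
    (hθ : θ ≤ D) : ENNReal.ofReal (sigLow K N τ D) ≤ sigmaCoeff K N τ θ := by
  have hp : 0 < N * Real.pi ^ 2 := by positivity
  unfold sigmaCoeff
  split_ifs with h1 h2 h3
  · exact le_top
  · have hK : 0 < K := by
      by_contra hK
      have := mul_nonneg (neg_nonneg.2 (not_lt.1 hK)) (sq_nonneg θ)
      linarith
    have hθp : 0 < θ := by
      rcases hθ0.eq_or_lt with h | h
      · rw [← h] at h2; simp at h2
      · exact h
    apply ENNReal.ofReal_le_ofReal
    rw [sigLow, if_pos hK.le]
    set x := θ * Real.sqrt (K / N) with hx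
    have hx0 : 0 < x := by positivity
    have hxpi : x < Real.pi := by
      have : x ^ 2 < Real.pi ^ 2 := by
        rw [hx, mul_pow, Real.sq_sqrt (by positivity)]
        rw [mul_div_assoc', div_lt_iff₀ (by linarith)]
        linarith
      exact lt_of_pow_lt_pow_left₀ 2 Real.pi_pos.le this
    have hs : 0 < Real.sin x := Real.sin_pos_of_pos_of_lt_pi hx0 hxpi
    rw [le_div_iff₀ hs, mul_assoc, ← hx]
    have := strictConcaveOn_sin_Icc.concaveOn.2 (⟨le_rfl, Real.pi_pos.le⟩ : (0:ℝ) ∈ Icc 0 Real.pi)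
      ⟨hx0.le, hxpi.le⟩ (by linarith : 0 ≤ 1 - τ) hτ0 (by ring)
    simpa using this
  · rcases mul_eq_zero.1 h3 with h | h
    · rw [sigLow, if_pos h.ge]
    · apply ENNReal.ofReal_le_ofReal
      unfold sigLow
      split_ifs with hK hD
      · exact le_rfl
      · exact le_rfl
      · have hDp : 0 < D := lt_of_le_of_ne (hθ0.trans hθ) (Ne.symm hD)
        have : 0 < -K / N := div_pos (by linarith) (by linarith)
        have hx : 0 < D * Real.sqrt (-K / N) := by positivity
        rw [div_le_iff₀ (Real.sinh_pos_iff.2 hx)]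
        exact sinh_mul_le' hτ0 hτ1 hx.le
  · have hneg : K * θ ^ 2 < 0 := lt_of_le_of_ne (not_lt.1 h2) h3
    have hK : K < 0 := by
      by_contra hK
      have := mul_nonneg (not_lt.1 hK) (sq_nonneg θ)
      linarith
    have hθp : 0 < θ := by
      rcases hθ0.eq_or_lt with h | h
      · rw [← h] at hneg; simp at hneg
      · exact h
    have hDp : 0 < D := hθp.trans_le hθ
    apply ENNReal.ofReal_le_ofReal
    rw [sigLow, if_neg (by linarith), if_neg hDp.ne', mul_assoc]
    have : 0 < -K / N := div_pos (by linarith) (by linarith)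
    have hx : 0 < Real.sqrt (-K / N) := by positivity
    exact sinh_ratio_anti hτ0 hτ1 (mul_pos hθp hx) (by gcongr)

lemma sigLow_pos {K N τ D : ℝ} (hN : 1 ≤ N) (hτ : 0 < τ) (hD : 0 ≤ D) : 0 < sigLow K N τ D := by
  unfold sigLow
  split_ifs with hK hD0
  · exact hτ
  · exact hτ
  · have hDp : 0 < D := lt_of_le_of_ne hD (Ne.symm hD0)
    have : 0 < -K / N := div_pos (by linarith) (by linarith)
    have hx : 0 < D * Real.sqrt (-K / N) := by positivity
    exact div_pos (Real.sinh_pos_iff.2 (by positivity)) (Real.sinh_pos_iff.2 hx)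

lemma sigLow_one {K N D : ℝ} (hN : 1 ≤ N) (hD : 0 ≤ D) : sigLow K N 1 D = 1 := by
  unfold sigLow
  split_ifs with hK hD0
  · rfl
  · rfl
  · have hDp : 0 < D := lt_of_le_of_ne hD (Ne.symm hD0)
    have : 0 < -K / N := div_pos (by linarith) (by linarith)
    have hx : 0 < D * Real.sqrt (-K / N) := by positivity
    rw [one_mul, div_self (Real.sinh_pos_iff.2 hx).ne']

lemma sigLow_mono {K N D τ τ' : ℝ} (hD : 0 ≤ D) (h : τ ≤ τ') :
    sigLow K N τ D ≤ sigLow K N τ' D := by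
  unfold sigLow
  split_ifs with hK hD0
  · exact h
  · exact h
  · have hx : 0 ≤ D * Real.sqrt (-K / N) := by positivity
    apply div_le_div_of_nonneg_right _ (Real.sinh_nonneg_iff.2 hx)
    exact Real.sinh_le_sinh.2 (by gcongr)

open Filter Topology in
lemma sigLow_tendsto {ι : Type*} {l : Filter ι} {f g : ι → ℝ} {K N τ D : ℝ} (hN : 1 ≤ N)
    (hD : 0 ≤ D) (hf : Tendsto f l (𝓝 N)) (hg : Tendsto g l (𝓝 τ)) :
    Tendsto (fun i => sigLow K (f i) (g i) D) l (𝓝 (sigLow K N τ D)) := by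
  unfold sigLow
  split_ifs with hK hD0
  · exact hg
  · exact hg
  · have hDp : 0 < D := lt_of_le_of_ne hD (Ne.symm hD0)
    have : 0 < -K / N := div_pos (by linarith) (by linarith)
    have hx : 0 < D * Real.sqrt (-K / N) := by positivity
    have h1 : Tendsto (fun i => D * Real.sqrt (-K / f i)) l (𝓝 (D * Real.sqrt (-K / N))) :=
      ((Real.continuous_sqrt.tendsto _).comp (tendsto_const_nhds.div hf (by linarith))).const_mul D
    exact ((Real.continuous_sinh.tendsto _).comp (hg.mul h1)).div
      ((Real.continuous_sinh.tendsto _).comp h1) (Real.sinh_pos_iff.2 hx).ne'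

open Filter Topology in
lemma sigLow_half_tendsto {K N : ℝ} (hN : 1 ≤ N) :
    Tendsto (fun h => sigLow K N (1/2) h) (𝓝[>] 0) (𝓝 (1/2)) := by
  by_cases hK : 0 ≤ K
  · simp only [sigLow, if_pos hK]; exact tendsto_const_nhds
  · have hpos : 0 < -K / N := div_pos (by linarith) (by linarith)
    have h1 : Tendsto (fun h : ℝ => 1 / (2 * Real.cosh (1 / 2 * (h * Real.sqrt (-K / N)))))
        (𝓝[>] 0) (𝓝 (1/2)) := by
      have : Continuous (fun h : ℝ => 1 / (2 * Real.cosh (1 / 2 * (h * Real.sqrt (-K / N))))) := by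
        refine continuous_const.div ?_ ?_
        · exact continuous_const.mul (Real.continuous_cosh.comp (by fun_prop))
        · intro x; have := Real.cosh_pos (1 / 2 * (x * Real.sqrt (-K / N))); positivity
      have h2 := this.tendsto 0
      simp only [zero_mul, mul_zero, Real.cosh_zero, mul_one] at h2
      exact h2.mono_left nhdsWithin_le_nhds
    refine h1.congr' ?_
    filter_upwards [self_mem_nhdsWithin] with h hh
    have hh0 : 0 < h := hh
    rw [sigLow, if_neg hK, if_neg hh0.ne']
    set y := 1 / 2 * (h * Real.sqrt (-K / N)) with hy
    have hy0 : 0 < y := by positivity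
    have : h * Real.sqrt (-K / N) = 2 * y := by rw [hy]; ring
    rw [this, Real.sinh_two_mul]
    have := Real.sinh_pos_iff.2 hy0
    have := Real.cosh_pos y
    field_simp


section MeasGeneral

open Measure

lemma exists_lift {Y Z : Type*} [MeasurableSpace Y] [MeasurableSpace Z] (α : Measure Y)
    [IsFiniteMeasure α] {f : Y → Z} (hf : Measurable f) {η : Measure Z} (h : η ≤ α.map f) :
    ∃ α' ≤ α, α'.map f = η := by
  have hfin : IsFiniteMeasure η := isFiniteMeasure_of_le _ h
  set g := η.rnDeriv (α.map f) with hg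
  have hgm : Measurable g := measurable_rnDeriv _ _
  refine ⟨α.withDensity (g ∘ f), ?_, ?_⟩
  · have h1 : g ≤ᵐ[α.map f] 1 := rnDeriv_le_one_of_le h
    have h2 : ∀ᵐ x ∂α, g (f x) ≤ 1 := ae_of_ae_map hf.aemeasurable h1
    calc α.withDensity (g ∘ f) ≤ α.withDensity 1 := withDensity_mono h2
      _ = α := withDensity_one
  · have h3 : (α.withDensity (g ∘ f)).map f = (α.map f).withDensity g := by
      ext s hs
      rw [map_apply hf hs, withDensity_apply _ (hf hs), withDensity_apply _ hs,
        setLIntegral_map hs hgm hf]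
      rfl
    rw [h3]
    exact withDensity_rnDeriv_eq _ _ (absolutelyContinuous_of_le h)

variable {Z : Type*} [MeasurableSpace Z]

/-- Renyi type functional. -/
def Fent (m : Measure Z) (p : ℝ) (μ : Measure Z) : ℝ≥0∞ := ∫⁻ x, (μ.rnDeriv m x) ^ p ∂m

variable {m : Measure Z} [SigmaFinite m] {p : ℝ}

lemma Fent_smul (hp : 0 < p) (μ : Measure Z) [IsFiniteMeasure μ] {c : ℝ≥0∞} (hc : c ≠ ⊤) :
    Fent m p (c • μ) = c ^ p * Fent m p μ := by
  unfold Fent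
  rw [← lintegral_const_mul _ ((measurable_rnDeriv _ _).pow_const p)]
  apply lintegral_congr_ae
  filter_upwards [rnDeriv_smul_left_of_ne_top μ m hc] with x hx
  rw [hx, Pi.smul_apply, smul_eq_mul, ENNReal.mul_rpow_of_nonneg _ _ hp.le]

lemma rnDeriv_zero_off (μ : Measure Z) {E : Set Z} (hE : MeasurableSet E)
    (h : μ Eᶜ = 0) : ∀ᵐ x ∂m, x ∈ Eᶜ → μ.rnDeriv m x = 0 := by
  have h1 : ∫⁻ x in Eᶜ, μ.rnDeriv m x ∂m = 0 :=
    le_antisymm ((setLIntegral_rnDeriv_le _).trans h.le) zero_le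
  rw [lintegral_eq_zero_iff (measurable_rnDeriv _ _)] at h1
  exact (ae_restrict_iff' hE.compl).1 h1

lemma Fent_holder (hp0 : 0 < p) (hp1 : p < 1) (μ : Measure Z) {E : Set Z}
    (hE : MeasurableSet E) (h : μ Eᶜ = 0) :
    Fent m p μ ≤ m E ^ (1 - p) * μ univ ^ p := by
  have hoff := rnDeriv_zero_off (m := m) μ hE h
  have hpq : (p⁻¹).HolderConjugate (1 - p)⁻¹ := by
    constructor <;> first | positivity | simp
  have h1 : Fent m p μ = ∫⁻ x, ((fun x => (μ.rnDeriv m x) ^ p) *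
      (E.indicator (1 : Z → ℝ≥0∞)) : Z → ℝ≥0∞) x ∂m := by
    apply lintegral_congr_ae
    filter_upwards [hoff] with x hx
    by_cases hxE : x ∈ E
    · simp [hxE]
    · simp [hxE, hx hxE, hp0]
  rw [h1]
  refine (ENNReal.lintegral_mul_le_Lp_mul_Lq m hpq
    ((measurable_rnDeriv _ _).pow_const p).aemeasurable
    (measurable_one.indicator hE).aemeasurable).trans ?_
  have h2 : ∫⁻ x, (E.indicator (1 : Z → ℝ≥0∞) x) ^ (1 - p)⁻¹ ∂m = m E := by
    rw [← lintegral_indicator_one hE]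
    apply lintegral_congr
    intro x
    by_cases hxE : x ∈ E
    · simp [hxE]
    · simp [hxE, hp1]
  have h3 : ∫⁻ x, ((μ.rnDeriv m x) ^ p) ^ p⁻¹ ∂m ≤ μ univ := by
    refine le_trans (le_of_eq ?_) (lintegral_rnDeriv_le (μ := μ) (ν := m))
    apply lintegral_congr
    intro x
    rw [← ENNReal.rpow_mul, mul_inv_cancel₀ hp0.ne', ENNReal.rpow_one]
  rw [h2, one_div, one_div, inv_inv, inv_inv, mul_comm]
  gcongr

lemma rnDeriv_le_of_le_smul (μ : Measure Z) {C : ℝ≥0∞} (h : μ ≤ C • m) :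
    ∀ᵐ x ∂m, μ.rnDeriv m x ≤ C := by
  apply ae_le_of_forall_setLIntegral_le_of_sigmaFinite (measurable_rnDeriv _ _)
  intro s hs _
  calc ∫⁻ x in s, μ.rnDeriv m x ∂m ≤ μ s := setLIntegral_rnDeriv_le s
    _ ≤ (C • m) s := h s
    _ = _ := by simp

lemma Fent_lower (hp1 : p < 1) (μ : Measure Z) [IsFiniteMeasure μ] {C : ℝ≥0∞}
    (hC0 : C ≠ 0) (hC : C ≠ ⊤) (h : μ ≤ C • m) :
    C ^ (-(1 - p)) * μ univ ≤ Fent m p μ := by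
  have hac : μ ≪ m := (absolutelyContinuous_of_le h).trans smul_absolutelyContinuous
  rw [← lintegral_rnDeriv hac, ← lintegral_const_mul _ (measurable_rnDeriv _ _)]
  apply lintegral_mono_ae
  filter_upwards [rnDeriv_le_of_le_smul μ h] with x hx
  rcases eq_or_ne (μ.rnDeriv m x) 0 with h0 | h0
  · simp [h0]
  · have ht : μ.rnDeriv m x ≠ ⊤ := ne_top_of_le_ne_top hC hx
    calc C ^ (-(1 - p)) * μ.rnDeriv m x ≤ (μ.rnDeriv m x) ^ (-(1 - p)) * μ.rnDeriv m x := by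
          gcongr ?_ * _
          rw [ENNReal.rpow_neg, ENNReal.rpow_neg, ENNReal.inv_le_inv]
          exact ENNReal.rpow_le_rpow hx (by linarith)
      _ = (μ.rnDeriv m x) ^ p := by
          nth_rw 2 [← ENNReal.rpow_one (μ.rnDeriv m x)]
          rw [← ENNReal.rpow_add _ _ h0 ht]
          congr 1; ring

lemma rpow_add_half (hp0 : 0 < p) (hp1 : p < 1) (a b : ℝ≥0∞) :
    a ^ p + b ^ p ≤ 2 ^ (1 - p) * (a + b) ^ p := by
  have h := ENNReal.rpow_add_le_mul_rpow_add_rpow (a ^ p) (b ^ p) (p := p⁻¹)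
    ((one_le_inv₀ hp0).2 hp1.le)
  have h2 := ENNReal.rpow_le_rpow h hp0.le
  rw [← ENNReal.rpow_mul, ENNReal.mul_rpow_of_nonneg _ _ hp0.le, ← ENNReal.rpow_mul,
    ← ENNReal.rpow_mul, ← ENNReal.rpow_mul, mul_inv_cancel₀ hp0.ne', inv_mul_cancel₀ hp0.ne',
    ENNReal.rpow_one, ENNReal.rpow_one, ENNReal.rpow_one, sub_mul, inv_mul_cancel₀ hp0.ne',
    one_mul] at h2
  exact h2

lemma Fent_add_half (hp0 : 0 < p) (hp1 : p < 1) (μ ν : Measure Z) [IsFiniteMeasure μ]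
    [IsFiniteMeasure ν] :
    Fent m p μ + Fent m p ν ≤ 2 ^ (1 - p) * Fent m p (μ + ν) := by
  unfold Fent
  rw [← lintegral_add_left ((measurable_rnDeriv _ _).pow_const p),
    ← lintegral_const_mul _ ((measurable_rnDeriv _ _).pow_const p)]
  apply lintegral_mono_ae
  filter_upwards [rnDeriv_add' μ ν m] with x hx
  rw [hx]
  exact rpow_add_half hp0 hp1 _ _

lemma Fent_add_sing (hp0 : 0 < p) (μ ν : Measure Z) [IsFiniteMeasure μ]
    [IsFiniteMeasure ν] (h : μ ⟂ₘ ν) :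
    Fent m p μ + Fent m p ν = Fent m p (μ + ν) := by
  obtain ⟨s, hs, h1, h2⟩ := h
  unfold Fent
  rw [← lintegral_add_left ((measurable_rnDeriv _ _).pow_const p)]
  apply lintegral_congr_ae
  have h3 := rnDeriv_zero_off (m := m) μ hs.compl (by simpa using h1)
  have h4 := rnDeriv_zero_off (m := m) ν hs h2
  filter_upwards [rnDeriv_add' μ ν m, h3, h4] with x hx h3 h4
  rw [hx, Pi.add_apply]
  by_cases hxs : x ∈ s
  · rw [h3 (by simpa using hxs)]; simp [hp0]
  · rw [h4 hxs]; simp [hp0]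

lemma Fent_int (hp0 : 0 < p) (μ : Measure Z) [IsFiniteMeasure μ] (h : μ ≪ m) :
    ∫⁻ x, (μ.rnDeriv m x) ^ (-(1 - p)) ∂μ ≥ Fent m p μ := by
  rw [← lintegral_rnDeriv_mul h ((measurable_rnDeriv _ _).pow_const _).aemeasurable]
  apply lintegral_mono_ae
  filter_upwards [rnDeriv_ne_top μ m] with x ht
  rcases eq_or_ne (μ.rnDeriv m x) 0 with h0 | h0
  · simp [h0, hp0]
  · apply le_of_eq
    nth_rw 2 [← ENNReal.rpow_one (μ.rnDeriv m x)]
    rw [← ENNReal.rpow_add _ _ h0 ht]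
    congr 1; ring

lemma Fent_ne_zero (hp0 : 0 < p) (μ : Measure Z) [IsFiniteMeasure μ] (h : Fent m p μ ≠ 0) :
    ¬ μ ⟂ₘ m := by
  intro hs
  apply h
  unfold Fent
  rw [lintegral_congr_ae (g := 0)]
  · simp
  · filter_upwards [hs.rnDeriv_ae_eq_zero] with x hx
    simp [hx, hp0]

end MeasGeneral


section GeoBasics

open Measure

lemma continuous_eval (t : unitInterval) : Continuous (eval t : Geo X → X) :=
  (continuous_eval_const t).comp continuous_subtype_val

lemma measurable_eval [BorelSpace X] (t : unitInterval) : Measurable (eval t : Geo X → X) :=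
  (continuous_eval t).measurable

/-- affine interpolation in the unit interval -/
def affI (a c u : unitInterval) : unitInterval :=
  ⟨(1 - (u : ℝ)) * a + u * c, by
    have ha := a.2.1; have ha1 := a.2.2; have hc := c.2.1; have hc1 := c.2.2
    have hu := u.2.1; have hu1 := u.2.2
    constructor
    · have : 0 ≤ 1 - (u : ℝ) := by linarith
      positivity
    · nlinarith⟩

lemma affI_coe (a c u : unitInterval) : (affI a c u : ℝ) = (1 - (u : ℝ)) * a + u * c := rfl

lemma affI_zero (a c : unitInterval) : affI a c 0 = a := by
  apply Subtype.ext; simp [affI_coe]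

lemma affI_one (a c : unitInterval) : affI a c 1 = c := by
  apply Subtype.ext; simp [affI_coe]

lemma continuous_affI (a c : unitInterval) : Continuous (affI a c) := by
  unfold affI
  fun_prop

/-- restriction of a geodesic -/
def rest (a c : unitInterval) (γ : Geo X) : Geo X :=
  ⟨γ.1.comp ⟨affI a c, continuous_affI a c⟩, by
    intro s t
    simp only [ContinuousMap.comp_apply, ContinuousMap.coe_mk, affI_zero, affI_one]
    rw [γ.2, γ.2 a c, ← mul_assoc, ← abs_mul, affI_coe, affI_coe,
      show (1 - (s : ℝ)) * a + s * c - ((1 - (t : ℝ)) * a + t * c) = -((s - t) * ((a : ℝ) - c)) by ring,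
      abs_neg]⟩

lemma eval_rest (a c u : unitInterval) (γ : Geo X) : eval u (rest a c γ) = eval (affI a c u) γ := rfl

lemma eval_rest_zero (a c : unitInterval) (γ : Geo X) : eval 0 (rest a c γ) = eval a γ := by
  rw [eval_rest, affI_zero]

lemma eval_rest_one (a c : unitInterval) (γ : Geo X) : eval 1 (rest a c γ) = eval c γ := by
  rw [eval_rest, affI_one]

lemma continuous_rest (a c : unitInterval) : Continuous (rest a c : Geo X → Geo X) := by
  apply Continuous.subtype_mk
  exact (ContinuousMap.continuous_precomp _).comp continuous_subtype_val

lemma measurable_rest (a c : unitInterval) : Measurable (rest a c : Geo X → Geo X) :=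
  (continuous_rest a c).measurable

/-- length -/
def len (γ : Geo X) : ℝ := dist (eval 0 γ) (eval 1 γ)

lemma dist_eval (s t : unitInterval) (γ : Geo X) :
    dist (eval s γ) (eval t γ) = |(s : ℝ) - t| * len γ := γ.2 s t

lemma len_nonneg (γ : Geo X) : 0 ≤ len γ := dist_nonneg

lemma len_rest (a c : unitInterval) (γ : Geo X) : len (rest a c γ) = |(a : ℝ) - c| * len γ := by
  rw [len, eval_rest_zero, eval_rest_one, dist_eval]

lemma measurable_len : Measurable (len : Geo X → ℝ) :=
  ((continuous_eval 0).dist (continuous_eval 1)).measurable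

/-- optimality of an unnormalized plan -/
def Opt (α : Measure (Geo X)) : Prop :=
  ∀ α' : Measure (Geo X), α'.map (eval 0) = α.map (eval 0) → α'.map (eval 1) = α.map (eval 1) →
    transportCost α ≤ transportCost α'

/-- bounded plan -/
def Bdd (α : Measure (Geo X)) : Prop :=
  ∃ (x0 : X) (R : ℝ), 0 ≤ R ∧ ∀ᵐ γ ∂α, dist (eval 0 γ) x0 ≤ R ∧ dist (eval 1 γ) x0 ≤ R

lemma Bdd.mono {α β : Measure (Geo X)} (h : Bdd α) (hβ : β ≪ α) : Bdd β := by
  obtain ⟨x0, R, hR, h⟩ := h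
  exact ⟨x0, R, hR, hβ.ae_le h⟩

lemma Bdd.add {α β : Measure (Geo X)} (h : Bdd α) (h' : Bdd β) : Bdd (α + β) := by
  obtain ⟨x0, R, hR, h⟩ := h
  obtain ⟨x1, R1, hR1, h1⟩ := h'
  refine ⟨x0, max R (R1 + dist x1 x0), le_max_of_le_left hR, ?_⟩
  rw [ae_add_measure_iff]
  constructor
  · filter_upwards [h] with γ hγ
    exact ⟨le_max_of_le_left hγ.1, le_max_of_le_left hγ.2⟩
  · filter_upwards [h1] with γ hγ
    exact ⟨le_max_of_le_right ((dist_triangle _ x1 _).trans (by linarith [hγ.1])),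
      le_max_of_le_right ((dist_triangle _ x1 _).trans (by linarith [hγ.2]))⟩

lemma Bdd.len_le {α : Measure (Geo X)} (h : Bdd α) : ∃ D : ℝ, 0 < D ∧ ∀ᵐ γ ∂α, len γ ≤ D := by
  obtain ⟨x0, R, hR, h⟩ := h
  refine ⟨2 * R + 1, by linarith, ?_⟩
  filter_upwards [h] with γ hγ
  have := dist_triangle_right (eval 0 γ) (eval 1 γ) x0
  unfold len; linarith [hγ.1, hγ.2]

lemma Bdd.rest {α : Measure (Geo X)} (h : Bdd α) (a c : unitInterval) :
    Bdd (α.map (rest a c)) := by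
  obtain ⟨x0, R, hR, h⟩ := h
  refine ⟨x0, 3 * R, by linarith, ?_⟩
  have key : ∀ᵐ γ ∂α, ∀ t : unitInterval, dist (eval t γ) x0 ≤ 3 * R := by
    filter_upwards [h] with γ hγ t
    have h1 := dist_triangle_right (eval 0 γ) (eval 1 γ) x0
    have h2 := dist_triangle (eval t γ) (eval 0 γ) x0
    have h3 := dist_eval t 0 γ
    have h4 : |(t : ℝ) - (0 : unitInterval)| ≤ 1 := by
      rw [abs_le]; constructor <;> simp <;> linarith [t.2.1, t.2.2]
    have h5 := mul_le_mul_of_nonneg_right h4 (len_nonneg γ)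
    have : len γ ≤ 2 * R := by unfold len; linarith [hγ.1, hγ.2]
    linarith [hγ.1]
  have hm : MeasurableSet {γ : Geo X | dist (eval 0 γ) x0 ≤ 3 * R ∧ dist (eval 1 γ) x0 ≤ 3 * R} := by
    apply IsClosed.measurableSet
    exact (isClosed_le ((continuous_eval 0).dist continuous_const) continuous_const).inter
      (isClosed_le ((continuous_eval 1).dist continuous_const) continuous_const)
  rw [ae_map_iff (measurable_rest a c).aemeasurable hm]
  filter_upwards [key] with γ hγ
  rw [eval_rest_zero, eval_rest_one]
  exact ⟨hγ a, hγ c⟩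

lemma Bdd.congr [BorelSpace X] {α β : Measure (Geo X)} (h : Bdd α)
    (h0 : β.map (eval 0) = α.map (eval 0)) (h1 : β.map (eval 1) = α.map (eval 1)) : Bdd β := by
  obtain ⟨x0, R, hR, h⟩ := h
  refine ⟨x0, R, hR, ?_⟩
  rw [Filter.eventually_and] at h ⊢
  have hm : MeasurableSet {x : X | dist x x0 ≤ R} := measurableSet_closedBall
  constructor
  · rw [← ae_map_iff (measurable_eval 0).aemeasurable hm, h0,
      ae_map_iff (measurable_eval 0).aemeasurable hm]
    exact h.1
  · rw [← ae_map_iff (measurable_eval 1).aemeasurable hm, h1,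
      ae_map_iff (measurable_eval 1).aemeasurable hm]
    exact h.2

lemma univ_of_map [BorelSpace X] {α β : Measure (Geo X)} {t : unitInterval}
    (h0 : β.map (eval t) = α.map (eval t)) : β univ = α univ := by
  have := congrArg (fun μ => μ univ) h0
  simpa [map_apply (measurable_eval t) MeasurableSet.univ] using this

lemma isFinite_of_map [BorelSpace X] {α β : Measure (Geo X)} [IsFiniteMeasure α] {t : unitInterval}
    (h0 : β.map (eval t) = α.map (eval t)) : IsFiniteMeasure β :=
  ⟨by rw [univ_of_map h0]; exact measure_lt_top _ _⟩

lemma cost_eq (α : Measure (Geo X)) : transportCost α = ∫⁻ γ, ENNReal.ofReal (len γ ^ 2) ∂α := rfl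

lemma cost_lt_top {α : Measure (Geo X)} [IsFiniteMeasure α] (h : Bdd α) : transportCost α ≠ ⊤ := by
  obtain ⟨D, hD, h⟩ := h.len_le
  rw [cost_eq]
  refine ne_top_of_le_ne_top (b := ENNReal.ofReal (D ^ 2) * α univ)
    (ENNReal.mul_ne_top ENNReal.ofReal_ne_top (measure_ne_top _ _)) ?_
  rw [← lintegral_const]
  apply lintegral_mono_ae
  filter_upwards [h] with γ hγ
  exact ENNReal.ofReal_le_ofReal (pow_le_pow_left₀ (len_nonneg γ) hγ 2)

lemma cost_add (α β : Measure (Geo X)) :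
    transportCost (α + β) = transportCost α + transportCost β := lintegral_add_measure _ _ _

lemma cost_smul (c : ℝ≥0∞) (α : Measure (Geo X)) :
    transportCost (c • α) = c * transportCost α := by
  simp [cost_eq, lintegral_smul_measure]

lemma cost_rest (α : Measure (Geo X)) (a c : unitInterval) :
    transportCost (α.map (rest a c)) = ENNReal.ofReal (((a : ℝ) - c) ^ 2) * transportCost α := by
  rw [cost_eq, lintegral_map (measurable_len.pow_const 2).ennreal_ofReal (measurable_rest a c),
    cost_eq, ← lintegral_const_mul _ (measurable_len.pow_const 2).ennreal_ofReal]
  congr 1; ext γ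
  rw [len_rest, mul_pow, sq_abs, ENNReal.ofReal_mul (sq_nonneg _)]

lemma map_rest_eval [BorelSpace X] (α : Measure (Geo X)) (a c u : unitInterval) :
    (α.map (rest a c)).map (eval u) = α.map (eval (affI a c u)) := by
  rw [map_map (measurable_eval u) (measurable_rest a c)]; rfl

lemma map_rest_zero [BorelSpace X] (α : Measure (Geo X)) (a c : unitInterval) :
    (α.map (rest a c)).map (eval 0) = α.map (eval a) := by
  rw [map_rest_eval, affI_zero]

lemma map_rest_one [BorelSpace X] (α : Measure (Geo X)) (a c : unitInterval) :
    (α.map (rest a c)).map (eval 1) = α.map (eval c) := by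
  rw [map_rest_eval, affI_one]

/-- O1 for sums -/
lemma Opt.left [BorelSpace X] {α β : Measure (Geo X)} [IsFiniteMeasure β]
    (hb : Bdd β) (h : Opt (α + β)) : Opt α := by
  intro α' h0 h1
  have := h (α' + β) (by rw [Measure.map_add _ _ (measurable_eval 0), h0, Measure.map_add _ _ (measurable_eval 0)])
    (by rw [Measure.map_add _ _ (measurable_eval 1), h1, Measure.map_add _ _ (measurable_eval 1)])
  rw [cost_add, cost_add] at this
  exact (ENNReal.add_le_add_iff_right (cost_lt_top hb)).1 this

lemma Opt.mono [BorelSpace X] {α β : Measure (Geo X)} [IsFiniteMeasure β]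
    (hb : Bdd β) (h : Opt β) (hle : α ≤ β) : Opt α := by
  have : IsFiniteMeasure α := isFiniteMeasure_of_le _ hle
  have e : α + (β - α) = β := by rw [add_comm]; exact Measure.sub_add_cancel_of_le hle
  rw [← e] at h
  have hle2 : β - α ≤ β := Measure.sub_le
  have : IsFiniteMeasure (β - α) := isFiniteMeasure_of_le _ hle2
  exact h.left (hb.mono (absolutelyContinuous_of_le hle2))

lemma map_smul_cancel {Y : Type*} [MeasurableSpace Y] {f : Geo X → Y} {c : ℝ≥0∞}
    (hc : c ≠ 0) (hc' : c ≠ ⊤) {α β : Measure (Geo X)}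
    (h : α.map f = (c • β).map f) : (c⁻¹ • α).map f = β.map f := by
  rw [Measure.map_smul, h, Measure.map_smul, smul_smul, ENNReal.inv_mul_cancel hc hc', one_smul]

lemma Opt.smul {β : Measure (Geo X)} (h : Opt β)
    {c : ℝ≥0∞} (hc : c ≠ 0) (hc' : c ≠ ⊤) : Opt (c • β) := by
  intro α h0 h1
  have := h (c⁻¹ • α) (map_smul_cancel hc hc' h0) (map_smul_cancel hc hc' h1)
  rw [cost_smul] at this ⊢
  calc c * transportCost β ≤ c * (c⁻¹ * transportCost α) := by gcongr
    _ = _ := by rw [← mul_assoc, ENNReal.mul_inv_cancel hc hc', one_mul]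

lemma Opt.mono_smul [BorelSpace X] {α β : Measure (Geo X)} [IsFiniteMeasure β]
    (hb : Bdd β) (h : Opt β) {c : ℝ≥0∞} (hc : c ≠ 0) (hc' : c ≠ ⊤) (hle : α ≤ c • β) : Opt α := by
  have : IsFiniteMeasure (c • β) := Measure.smul_finite β hc'
  exact Opt.mono (β := c • β) (hb.mono smul_absolutelyContinuous) (h.smul hc hc') hle

lemma Opt.congr {α β : Measure (Geo X)} (h : Opt β)
    (h0 : α.map (eval 0) = β.map (eval 0)) (h1 : α.map (eval 1) = β.map (eval 1))
    (hc : transportCost α ≤ transportCost β) : Opt α := by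
  intro γ e0 e1
  exact hc.trans (h γ (e0.trans h0) (e1.trans h1))

/-- L5 -/
lemma Opt.replace [BorelSpace X] {α1 α2 α1' : Measure (Geo X)}
    (h : Opt (α1 + α2)) (h' : Opt α1')
    (h0 : α1'.map (eval 0) = α1.map (eval 0)) (h1 : α1'.map (eval 1) = α1.map (eval 1)) :
    Opt (α1' + α2) := by
  refine h.congr ?_ ?_ ?_
  · rw [Measure.map_add _ _ (measurable_eval 0), h0, Measure.map_add _ _ (measurable_eval 0)]
  · rw [Measure.map_add _ _ (measurable_eval 1), h1, Measure.map_add _ _ (measurable_eval 1)]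
  · rw [cost_add, cost_add]
    gcongr
    exact h' _ h0.symm h1.symm

lemma IsOptGeo.opt [BorelSpace X] {μ ν : Measure X} {π : Measure (Geo X)} (h : IsOptGeo μ ν π) :
    Opt π := by
  obtain ⟨hp, h0, h1, h⟩ := h
  intro α' e0 e1
  have : IsProbabilityMeasure α' := ⟨by rw [univ_of_map e0]; exact measure_univ⟩
  exact h α' this (e0.trans h0) (e1.trans h1)

lemma Opt.isOptGeo {π : Measure (Geo X)} [IsProbabilityMeasure π] (h : Opt π) :
    IsOptGeo (π.map (eval 0)) (π.map (eval 1)) π :=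
  ⟨inferInstance, rfl, rfl, fun π' _ e0 e1 => h π' e0 e1⟩

end GeoBasics


section CDpart

open Measure

/-- unnormalized CD inequality with constant lower bounds -/
def CDineq (K N : ℝ) (m : Measure X) (α : Measure (Geo X)) : Prop :=
  ∀ (t : unitInterval) (n : ℝ), N ≤ n → 1 < n → ∀ s0 s1 : ℝ≥0∞,
    (∀ᵐ γ ∂α, s0 ≤ sigmaCoeff K n (1 - (t : ℝ)) (len γ)) →
    (∀ᵐ γ ∂α, s1 ≤ sigmaCoeff K n (t : ℝ) (len γ)) →
    (s0 = 0 ∨ α.map (eval 0) ≪ m) → (s1 = 0 ∨ α.map (eval 1) ≪ m) →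
    s0 * Fent m (1 - 1 / n) (α.map (eval 0)) + s1 * Fent m (1 - 1 / n) (α.map (eval 1)) ≤
      Fent m (1 - 1 / n) (α.map (eval t))

lemma p_pos {n : ℝ} (hn : 1 < n) : 0 < 1 - 1 / n := by
  have : 1 / n < 1 := by rw [div_lt_one (by linarith)]; exact hn
  linarith

lemma p_lt {n : ℝ} (hn : 1 < n) : 1 - 1 / n < 1 := by
  have : 0 < 1 / n := by positivity
  linarith

variable [BorelSpace X] {K N : ℝ} {m : Measure X} [SigmaFinite m]

lemma cd_term {π : Measure (Geo X)} [IsFiniteMeasure π] {u : unitInterval} {n : ℝ} (hn : 1 < n)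
    {s0 : ℝ≥0∞} (h : s0 = 0 ∨ π.map (eval u) ≪ m) :
    s0 * Fent m (1 - 1 / n) (π.map (eval u)) ≤
      ∫⁻ γ, s0 * ((π.map (eval u)).rnDeriv m (eval u γ)) ^ (-(1 / n)) ∂π := by
  rcases h with h | h
  · simp [h]
  · have hm1 : Measurable fun x => ((π.map (eval u)).rnDeriv m x) ^ (-(1 / n)) :=
      (measurable_rnDeriv _ _).pow_const _
    have hm2 : Measurable fun γ => ((π.map (eval u)).rnDeriv m (eval u γ)) ^ (-(1 / n)) :=
      hm1.comp (measurable_eval u)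
    rw [lintegral_const_mul _ hm2]
    gcongr
    rw [← lintegral_map hm1 (measurable_eval u)]
    have := Fent_int (m := m) (p_pos hn) (π.map (eval u)) h
    simpa using this

lemma cd_of_int {π : Measure (Geo X)} [IsFiniteMeasure π]
    (h : ∀ t : unitInterval, ∀ N' : ℝ, N ≤ N' →
        ∫⁻ γ, (sigmaCoeff K N' (1 - (t : ℝ)) (dist (eval 0 γ) (eval 1 γ)) *
                 ((π.map (eval 0)).rnDeriv m (eval 0 γ)) ^ (-(1 / N')) +
               sigmaCoeff K N' (t : ℝ) (dist (eval 0 γ) (eval 1 γ)) *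
                 ((π.map (eval 1)).rnDeriv m (eval 1 γ)) ^ (-(1 / N'))) ∂π
          ≤ ∫⁻ x, ((π.map (eval t)).rnDeriv m x) ^ (1 - 1 / N') ∂m) : CDineq K N m π := by
  intro t n hNn hn s0 s1 h0 h1 a0 a1
  refine le_trans ?_ (h t n hNn)
  refine (add_le_add (cd_term hn a0) (cd_term hn a1)).trans ?_
  have hm1 : Measurable fun γ => s0 * ((π.map (eval 0)).rnDeriv m (eval 0 γ)) ^ (-(1 / n)) :=
    (((measurable_rnDeriv _ _).comp (measurable_eval 0)).pow_const _).const_mul _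
  rw [← lintegral_add_left hm1]
  apply lintegral_mono_ae
  filter_upwards [h0, h1] with γ g0 g1
  unfold len at g0 g1
  gcongr

lemma CDineq.smul {π : Measure (Geo X)} [IsFiniteMeasure π] (h : CDineq K N m π) {c : ℝ≥0∞}
    (hc : c ≠ 0) (hc' : c ≠ ⊤) : CDineq K N m (c • π) := by
  intro t n hNn hn s0 s1 h0 h1 a0 a1
  have hac : π ≪ c • π := absolutelyContinuous_smul hc
  have := h t n hNn hn s0 s1 (hac.ae_le h0) (hac.ae_le h1)
    (a0.imp_right fun h => (hac.map (measurable_eval 0)).trans h)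
    (a1.imp_right fun h => (hac.map (measurable_eval 1)).trans h)
  simp only [Measure.map_smul]
  rw [Fent_smul (p_pos hn) _ hc', Fent_smul (p_pos hn) _ hc', Fent_smul (p_pos hn) _ hc',
    mul_left_comm, mul_left_comm s1, ← mul_add]
  gcongr

lemma Fent_zero {Z : Type*} [MeasurableSpace Z] (m : Measure Z) [SigmaFinite m] {p : ℝ} (hp : 0 < p) :
    Fent m p 0 = 0 := by
  unfold Fent
  rw [lintegral_congr_ae (g := 0)]
  · simp
  · filter_upwards [rnDeriv_zero m] with x hx
    simp [hx, hp]

lemma CDineq_zero : CDineq K N m (0 : Measure (Geo X)) := by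
  intro t n hNn hn s0 s1 h0 h1 a0 a1
  simp only [Measure.map_zero, Fent_zero m (p_pos hn), mul_zero, add_zero, le_refl]

/-- normalization data -/
lemma norm_prob (α : Measure (Geo X)) [IsFiniteMeasure α] (h0 : α ≠ 0) :
    IsProbabilityMeasure ((α univ)⁻¹ • α) := by
  constructor
  rw [Measure.smul_apply, smul_eq_mul]
  exact ENNReal.inv_mul_cancel (by simpa using h0) (measure_ne_top _ _)

lemma exists_cd_prob (hCD : IsCDStar K N m) {α : Measure (Geo X)} [IsProbabilityMeasure α]
    (hb : Bdd α) : ∃ α' : Measure (Geo X), IsProbabilityMeasure α' ∧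
      α'.map (eval 0) = α.map (eval 0) ∧ α'.map (eval 1) = α.map (eval 1) ∧ Opt α' ∧
      CDineq K N m α' := by
  obtain ⟨x0, R, hR, h⟩ := hb
  have hm : MeasurableSet (closedBall x0 R)ᶜ := measurableSet_closedBall.compl
  have hp0 : IsProbabilityMeasure (α.map (eval 0)) := isProbabilityMeasure_map (measurable_eval 0).aemeasurable
  have hp1 : IsProbabilityMeasure (α.map (eval 1)) := isProbabilityMeasure_map (measurable_eval 1).aemeasurable
  obtain ⟨π, hπ, hcd⟩ := hCD (α.map (eval 0)) (α.map (eval 1)) hp0 hp1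
    ⟨closedBall x0 R, isBounded_closedBall, by
      rw [map_apply (measurable_eval 0) hm]
      exact h.mono fun γ hγ => by simpa using hγ.1, by
      rw [map_apply (measurable_eval 1) hm]
      exact h.mono fun γ hγ => by simpa using hγ.2⟩
  have hf := hπ.1
  exact ⟨π, hf, hπ.2.1, hπ.2.2.1, hπ.opt, cd_of_int hcd⟩

lemma exists_cd (hCD : IsCDStar K N m) {α : Measure (Geo X)} [IsFiniteMeasure α]
    (hb : Bdd α) : ∃ α' : Measure (Geo X), IsFiniteMeasure α' ∧
      α'.map (eval 0) = α.map (eval 0) ∧ α'.map (eval 1) = α.map (eval 1) ∧ Opt α' ∧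
      CDineq K N m α' := by
  rcases eq_or_ne α 0 with rfl | h0
  · exact ⟨0, inferInstance, rfl, rfl, fun _ _ _ => by simp [cost_eq], CDineq_zero⟩
  · have hp := norm_prob α h0
    have hc : α univ ≠ 0 := by simpa using h0
    have hc' := measure_ne_top α univ
    obtain ⟨π, hπ, e0, e1, ho, hcd⟩ := exists_cd_prob hCD (α := (α univ)⁻¹ • α)
      (hb.mono smul_absolutelyContinuous)
    refine ⟨α univ • π, Measure.smul_finite π hc', ?_, ?_, ho.smul hc hc', hcd.smul hc hc'⟩
    · rw [Measure.map_smul, e0, Measure.map_smul, smul_smul, ENNReal.mul_inv_cancel hc hc', one_smul]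
    · rw [Measure.map_smul, e1, Measure.map_smul, smul_smul, ENNReal.mul_inv_cancel hc hc', one_smul]

lemma second_moment {μ : Measure X} [IsFiniteMeasure μ] {x0 : X} {R : ℝ} 
    (h : ∀ᵐ x ∂μ, dist x x0 ≤ R) : HasFiniteSecondMoment μ := by
  refine ⟨x0, ne_top_of_le_ne_top (b := ENNReal.ofReal (R ^ 2) * μ univ)
    (ENNReal.mul_ne_top ENNReal.ofReal_ne_top (measure_ne_top _ _)) ?_⟩
  rw [← lintegral_const]
  apply lintegral_mono_ae
  filter_upwards [h] with x hx
  exact ENNReal.ofReal_le_ofReal (pow_le_pow_left₀ dist_nonneg hx 2)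

/-- L6 -/
lemma cd_of_opt (hCD : IsCDStar K N m) (hGT : GoodTransport m) {α : Measure (Geo X)}
    [IsFiniteMeasure α] (hb : Bdd α) (ho : Opt α) (a0 : α.map (eval 0) ≪ m)
    (a1 : α.map (eval 1) ≪ m) : CDineq K N m α := by
  rcases eq_or_ne α 0 with rfl | h0
  · exact CDineq_zero
  have hp := norm_prob α h0
  have hc : α univ ≠ 0 := by simpa using h0
  have hc' := measure_ne_top α univ
  set β := (α univ)⁻¹ • α with hβ
  have hbβ : Bdd β := hb.mono smul_absolutelyContinuous
  have hoβ : Opt β := ho.smul (ENNReal.inv_ne_zero.2 hc') (ENNReal.inv_ne_top.2 hc)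
  obtain ⟨π, hπ, e0, e1, hoπ, hcd⟩ := exists_cd_prob hCD hbβ
  have hp0 : IsProbabilityMeasure (β.map (eval 0)) := isProbabilityMeasure_map (measurable_eval 0).aemeasurable
  have hp1 : IsProbabilityMeasure (β.map (eval 1)) := isProbabilityMeasure_map (measurable_eval 1).aemeasurable
  have hac : β ≪ α := smul_absolutelyContinuous
  obtain ⟨x0, R, hR, h⟩ := hbβ
  rw [Filter.eventually_and] at h
  have hm : MeasurableSet {x : X | dist x x0 ≤ R} := measurableSet_closedBall
  have hu := (hGT (β.map (eval 0)) (β.map (eval 1)) hp0 hp1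
    (second_moment (x0 := x0) (R := R) ((ae_map_iff (measurable_eval 0).aemeasurable hm).2 h.1))
    (second_moment (x0 := x0) (R := R) ((ae_map_iff (measurable_eval 1).aemeasurable hm).2 h.2))
    ((hac.map (measurable_eval 0)).trans a0) ((hac.map (measurable_eval 1)).trans a1)).1
  have h1 := hoπ.isOptGeo
  rw [e0, e1] at h1
  have heq : β = π := hu.unique hoβ.isOptGeo h1
  have : α = α univ • π := by
    rw [← heq, hβ, smul_smul, ENNReal.mul_inv_cancel hc hc', one_smul]
  rw [this]
  exact hcd.smul hc hc'

end CDpart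


section Gluing

open Measure ProbabilityTheory

variable [BorelSpace X] {K N : ℝ} {m : Measure X}

lemma exists_plan (hCD : IsCDStar K N m) (μ0 μ1 : Measure X) [IsFiniteMeasure μ0]
    (hmass : μ1 univ = μ0 univ) {x0 : X} {R : ℝ}
    (h0 : ∀ᵐ x ∂μ0, dist x x0 ≤ R) (h1 : ∀ᵐ x ∂μ1, dist x x0 ≤ R) :
    ∃ α : Measure (Geo X), α.map (eval 0) = μ0 ∧ α.map (eval 1) = μ1 := by
  rcases eq_or_ne μ0 0 with h | h
  · subst h
    have : μ1 = 0 := by simpa using hmass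
    exact ⟨0, by simp, by simp [this]⟩
  have hc : μ0 univ ≠ 0 := by simpa using h
  have hc' := measure_ne_top μ0 univ
  have hm : MeasurableSet (closedBall x0 R)ᶜ := measurableSet_closedBall.compl
  have hz0 : μ0 (closedBall x0 R)ᶜ = 0 := by
    refine measure_mono_null ?_ h0
    intro x hx; simpa using hx
  have hz1 : μ1 (closedBall x0 R)ᶜ = 0 := by
    refine measure_mono_null ?_ h1
    intro x hx; simpa using hx
  obtain ⟨π, hπ, -⟩ := hCD ((μ0 univ)⁻¹ • μ0) ((μ0 univ)⁻¹ • μ1)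
    ⟨by simp [ENNReal.inv_mul_cancel hc hc']⟩
    ⟨by simp [hmass, ENNReal.inv_mul_cancel hc hc']⟩
    ⟨closedBall x0 R, isBounded_closedBall, by simp [hz0], by simp [hz1]⟩
  refine ⟨μ0 univ • π, ?_, ?_⟩
  · rw [Measure.map_smul, hπ.2.1, smul_smul, ENNReal.mul_inv_cancel hc hc', one_smul]
  · rw [Measure.map_smul, hπ.2.2.1, smul_smul, ENNReal.mul_inv_cancel hc hc', one_smul]

lemma exists_cells [TopologicalSpace.SeparableSpace X] [Nonempty X] {ε : ℝ} (hε : 0 < ε) :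
    ∃ (u : ℕ → X) (g : X → ℕ), Measurable g ∧ ∀ x, dist x (u (g x)) < ε := by
  classical
  have hd := TopologicalSpace.denseRange_denseSeq X
  have hex : ∀ x, ∃ n, dist x (TopologicalSpace.denseSeq X n) < ε := fun x =>
    hd.exists_dist_lt x hε
  refine ⟨TopologicalSpace.denseSeq X, fun x => Nat.find (hex x), ?_, fun x => Nat.find_spec (hex x)⟩
  apply measurable_find
  intro k
  exact (isOpen_lt (continuous_id.dist continuous_const) continuous_const).measurableSet

lemma exists_plan_coupling [SecondCountableTopology X]
    (hCD : IsCDStar K N m) (q : Measure (X × X)) [IsFiniteMeasure q]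
    {x0 : X} {R : ℝ} (hb : ∀ᵐ p ∂q, dist p.1 x0 ≤ R ∧ dist p.2 x0 ≤ R) {ε : ℝ} (hε : 0 < ε) :
    ∃ α : Measure (Geo X), α.map (eval 0) = q.map Prod.fst ∧ α.map (eval 1) = q.map Prod.snd ∧
      transportCost α ≤ ∫⁻ p, ENNReal.ofReal ((dist p.1 p.2 + 4 * ε) ^ 2) ∂q := by
  have : Nonempty X := ⟨x0⟩
  obtain ⟨u, g, hg, hug⟩ := exists_cells (X := X) hε
  set G : X × X → ℕ × ℕ := fun p => (g p.1, g p.2) with hG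
  have hGm : Measurable G := (hg.comp measurable_fst).prodMk (hg.comp measurable_snd)
  set s : ℕ × ℕ → Set (X × X) := fun k => G ⁻¹' {k} with hs
  have hsm : ∀ k, MeasurableSet (s k) := fun k => hGm (measurableSet_singleton k)
  have hq : q = Measure.sum fun k => q.restrict (s k) := by
    rw [← restrict_iUnion (fun i j hij => by
      apply Disjoint.preimage; simpa using hij) hsm]
    have : (⋃ k, s k) = univ := by ext p; simp [hs]
    rw [this, restrict_univ]
  have hα : ∀ k, ∃ α : Measure (Geo X), α.map (eval 0) = (q.restrict (s k)).map Prod.fst ∧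
      α.map (eval 1) = (q.restrict (s k)).map Prod.snd := by
    intro k
    have hb' := ae_restrict_of_ae (s := s k) hb
    rw [Filter.eventually_and] at hb'
    have hm : MeasurableSet {x : X | dist x x0 ≤ R} := measurableSet_closedBall
    exact exists_plan hCD ((q.restrict (s k)).map Prod.fst) ((q.restrict (s k)).map Prod.snd)
      (by rw [map_apply measurable_fst .univ, map_apply measurable_snd .univ]; simp)
      (x0 := x0) (R := R)
      ((ae_map_iff measurable_fst.aemeasurable hm).2 hb'.1)
      ((ae_map_iff measurable_snd.aemeasurable hm).2 hb'.2)
  choose α hα0 hα1 using hα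
  refine ⟨Measure.sum α, ?_, ?_, ?_⟩
  · rw [Measure.map_sum (measurable_eval 0).aemeasurable]
    conv_rhs => rw [hq, Measure.map_sum measurable_fst.aemeasurable]
    simp_rw [hα0]
  · rw [Measure.map_sum (measurable_eval 1).aemeasurable]
    conv_rhs => rw [hq, Measure.map_sum measurable_snd.aemeasurable]
    simp_rw [hα1]
  · conv_rhs => rw [hq]
    rw [cost_eq, lintegral_sum_measure, lintegral_sum_measure]
    apply ENNReal.tsum_le_tsum
    intro k
    have hmass : (α k) univ = (q.restrict (s k)) univ := by
      have := congrArg (fun μ => μ univ) (hα0 k)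
      simpa [map_apply (measurable_eval 0) MeasurableSet.univ,
        map_apply measurable_fst MeasurableSet.univ] using this
    have hmem : ∀ᵐ p ∂(q.restrict (s k)), p ∈ s k := ae_restrict_mem (hsm k)
    have e0 : ∀ᵐ γ ∂(α k), dist (eval 0 γ) (u k.1) < ε := by
      have hm : MeasurableSet {x : X | dist x (u k.1) < ε} := measurableSet_ball
      rw [← ae_map_iff (measurable_eval 0).aemeasurable hm, hα0,
        ae_map_iff measurable_fst.aemeasurable hm]
      filter_upwards [hmem] with p hp
      have : g p.1 = k.1 := congrArg Prod.fst hp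
      rw [← this]; exact hug _
    have e1 : ∀ᵐ γ ∂(α k), dist (eval 1 γ) (u k.2) < ε := by
      have hm : MeasurableSet {x : X | dist x (u k.2) < ε} := measurableSet_ball
      rw [← ae_map_iff (measurable_eval 1).aemeasurable hm, hα1,
        ae_map_iff measurable_snd.aemeasurable hm]
      filter_upwards [hmem] with p hp
      have : g p.2 = k.2 := congrArg Prod.snd hp
      rw [← this]; exact hug _
    calc ∫⁻ γ, ENNReal.ofReal (len γ ^ 2) ∂(α k)
        ≤ ∫⁻ γ, ENNReal.ofReal ((dist (u k.1) (u k.2) + 2 * ε) ^ 2) ∂(α k) := by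
          apply lintegral_mono_ae
          filter_upwards [e0, e1] with γ h0 h1
          apply ENNReal.ofReal_le_ofReal
          apply pow_le_pow_left₀ (len_nonneg γ)
          have := dist_triangle4 (eval 0 γ) (u k.1) (u k.2) (eval 1 γ)
          rw [dist_comm (u k.2)] at this
          unfold len; linarith
      _ = ∫⁻ p, ENNReal.ofReal ((dist (u k.1) (u k.2) + 2 * ε) ^ 2) ∂(q.restrict (s k)) := by
          rw [lintegral_const, lintegral_const, hmass]
      _ ≤ _ := by
          apply lintegral_mono_ae
          filter_upwards [hmem] with p hp
          apply ENNReal.ofReal_le_ofReal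
          apply pow_le_pow_left₀ (by positivity)
          have h1 : g p.1 = k.1 := congrArg Prod.fst hp
          have h2 : g p.2 = k.2 := congrArg Prod.snd hp
          have h3 := hug p.1
          have h4 := hug p.2
          rw [h1] at h3; rw [h2] at h4
          have := dist_triangle4 (u k.1) p.1 p.2 (u k.2)
          rw [dist_comm (u k.1) p.1] at this
          linarith

/-- an optimal plan beats every coupling -/
lemma Opt.le_coupling [SecondCountableTopology X]
    (hCD : IsCDStar K N m) {α : Measure (Geo X)} (ho : Opt α) (q : Measure (X × X)) [IsFiniteMeasure q]
    {x0 : X} {R : ℝ} (hb : ∀ᵐ p ∂q, dist p.1 x0 ≤ R ∧ dist p.2 x0 ≤ R)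
    (h0 : q.map Prod.fst = α.map (eval 0)) (h1 : q.map Prod.snd = α.map (eval 1)) :
    transportCost α ≤ ∫⁻ p, ENNReal.ofReal (dist p.1 p.2 ^ 2) ∂q := by
  have key : ∀ ε : ℝ, ε ∈ Ioc (0 : ℝ) 1 → transportCost α ≤
      ∫⁻ p, ENNReal.ofReal (dist p.1 p.2 ^ 2) ∂q +
        ENNReal.ofReal (ε * (16 * |R| + 16)) * q univ := by
    intro ε hε
    obtain ⟨β, e0, e1, hc⟩ := exists_plan_coupling hCD q hb hε.1
    refine (ho β (e0.trans h0) (e1.trans h1)).trans (hc.trans ?_)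
    rw [← lintegral_const, ← lintegral_add_right _ measurable_const]
    apply lintegral_mono_ae
    filter_upwards [hb] with p hp
    have h5 : (0 : ℝ) ≤ ε * (16 * |R| + 16) := by have := hε.1; positivity
    rw [← ENNReal.ofReal_add (by positivity) h5]
    apply ENNReal.ofReal_le_ofReal
    have := dist_triangle_right p.1 p.2 x0
    have h2 : dist p.1 p.2 ≤ 2 * |R| := by linarith [le_abs_self R]
    nlinarith [mul_le_mul_of_nonneg_left h2 hε.1.le, hε.1, hε.2]
  have lim : Filter.Tendsto (fun ε : ℝ => ∫⁻ p, ENNReal.ofReal (dist p.1 p.2 ^ 2) ∂q +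
        ENNReal.ofReal (ε * (16 * |R| + 16)) * q univ) (nhdsWithin 0 (Ioi 0))
      (nhds (∫⁻ p, ENNReal.ofReal (dist p.1 p.2 ^ 2) ∂q + ENNReal.ofReal (0 * (16 * |R| + 16)) * q univ)) := by
    apply Filter.Tendsto.const_add
    apply ENNReal.Tendsto.mul_const _ (Or.inr (measure_ne_top _ _))
    apply (ENNReal.continuous_ofReal.tendsto _).comp
    apply Filter.Tendsto.mono_left _ nhdsWithin_le_nhds
    exact (continuous_id.mul continuous_const).tendsto 0
  simp only [zero_mul, ENNReal.ofReal_zero, add_zero] at lim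
  refine ge_of_tendsto lim ?_
  filter_upwards [Ioc_mem_nhdsGT (show (0 : ℝ) < 1 by norm_num)] with ε hε
  exact key ε hε

end Gluing


section Restrict

open Measure ProbabilityTheory

variable [BorelSpace X] {K N : ℝ} {m : Measure X}

lemma rest_rest (a c u v : unitInterval) (γ : Geo X) :
    rest u v (rest a c γ) = rest (affI a c u) (affI a c v) γ := by
  apply Subtype.ext
  ext w
  show eval w (rest u v (rest a c γ)) = eval w (rest (affI a c u) (affI a c v) γ)
  rw [eval_rest, eval_rest, eval_rest]
  congr 1
  apply Subtype.ext
  simp only [affI_coe]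
  ring

lemma rest_zero_one (γ : Geo X) : rest 0 1 γ = γ := by
  apply Subtype.ext
  ext w
  show eval w (rest 0 1 γ) = eval w γ
  rw [eval_rest]
  congr 1
  apply Subtype.ext
  simp [affI_coe]

lemma map_rest_rest (α : Measure (Geo X)) (a c u v : unitInterval) :
    (α.map (rest a c)).map (rest u v) = α.map (rest (affI a c u) (affI a c v)) := by
  rw [map_map (measurable_rest u v) (measurable_rest a c)]
  congr 1
  ext1 γ
  exact rest_rest a c u v γ

lemma map_rest_id (α : Measure (Geo X)) : α.map (rest 0 1) = α := by
  have : (rest 0 1 : Geo X → Geo X) = id := funext rest_zero_one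
  rw [this, map_id]

lemma map_rev_rev (α : Measure (Geo X)) : (α.map (rest 1 0)).map (rest 1 0) = α := by
  rw [map_rest_rest, affI_one, affI_zero, map_rest_id]

lemma cost_rev (α : Measure (Geo X)) : transportCost (α.map (rest 1 0)) = transportCost α := by
  rw [cost_rest]; simp

lemma Opt.rev {α : Measure (Geo X)} (h : Opt α) : Opt (α.map (rest 1 0)) := by
  intro β e0 e1
  rw [cost_rev, ← cost_rev β]
  apply h
  · rw [map_rest_zero, e1, map_rest_one]
  · rw [map_rest_one, e0, map_rest_zero]

lemma Opt.rest_left [SecondCountableTopology X] [CompleteSpace X]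
    (hCD : IsCDStar K N m) {α : Measure (Geo X)} [IsFiniteMeasure α] (hb : Bdd α) (ho : Opt α)
    {r : unitInterval} (hr0 : 0 < (r : ℝ)) (hr1 : (r : ℝ) < 1) : Opt (α.map (rest 0 r)) := by
  intro α' e0 e1
  rw [map_rest_zero] at e0
  rw [map_rest_one] at e1
  have hfin : IsFiniteMeasure α' := isFinite_of_map e0
  have hbb := hb
  obtain ⟨x0, R, hR, hb⟩ := hb
  have : Nonempty X := ⟨x0⟩
  have mE : ∀ a b : unitInterval, Measurable fun γ : Geo X => (eval a γ, eval b γ) := fun a b =>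
    (measurable_eval a).prodMk (measurable_eval b)
  set q1 := α'.map fun γ => (eval 0 γ, eval 1 γ) with hq1
  set q2 := α.map fun γ => (eval r γ, eval 1 γ) with hq2
  set Q := q1 ⊗ₘ (Kernel.prodMkLeft X q2.condKernel) with hQ
  have hq1s : q1.map Prod.snd = α.map (eval r) := by
    rw [hq1, map_map measurable_snd (mE 0 1), ← e1]; rfl
  have hq2f : q2.fst = α.map (eval r) := by
    rw [Measure.fst, hq2, map_map measurable_fst (mE r 1)]; rfl
  have hQ1 : Q.map Prod.fst = q1 := Measure.fst_compProd _ _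
  have hmid : Measurable fun p : (X × X) × X => (p.1.2, p.2) := by fun_prop
  have hQ2 : Q.map (fun p => (p.1.2, p.2)) = q2 := by
    conv_rhs => rw [← q2.disintegrate q2.condKernel, hq2f, ← hq1s]
    ext s hs
    rw [map_apply hmid hs, hQ, compProd_apply (hmid hs), compProd_apply hs,
      lintegral_map (Kernel.measurable_kernel_prodMk_left hs) measurable_snd]
    rfl
  have hout : Measurable fun p : (X × X) × X => (p.1.1, p.2) := by fun_prop
  set q := Q.map (fun p => (p.1.1, p.2)) with hq
  have hqf : q.map Prod.fst = α.map (eval 0) := by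
    rw [hq, map_map measurable_fst hout, ← e0]
    have : (Prod.fst ∘ fun p : (X × X) × X => (p.1.1, p.2)) = Prod.fst ∘ Prod.fst := rfl
    rw [this, ← map_map measurable_fst measurable_fst, hQ1, hq1, map_map measurable_fst (mE 0 1)]
    rfl
  have hqs : q.map Prod.snd = α.map (eval 1) := by
    rw [hq, map_map measurable_snd hout]
    have : (Prod.snd ∘ fun p : (X × X) × X => (p.1.1, p.2)) =
      Prod.snd ∘ (fun p : (X × X) × X => (p.1.2, p.2)) := rfl
    rw [this, ← map_map measurable_snd hmid, hQ2, hq2, map_map measurable_snd (mE r 1)]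
    rfl
  have hbq : ∀ᵐ p ∂q, dist p.1 x0 ≤ R ∧ dist p.2 x0 ≤ R := by
    rw [Filter.eventually_and] at hb ⊢
    have hm : MeasurableSet {x : X | dist x x0 ≤ R} := measurableSet_closedBall
    constructor
    · rw [← ae_map_iff (f := Prod.fst) (p := fun x => dist x x0 ≤ R) measurable_fst.aemeasurable hm,
        hqf, ae_map_iff (measurable_eval 0).aemeasurable hm]
      exact hb.1
    · rw [← ae_map_iff (f := Prod.snd) (p := fun x => dist x x0 ≤ R) measurable_snd.aemeasurable hm,
        hqs, ae_map_iff (measurable_eval 1).aemeasurable hm]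
      exact hb.2
  have h1 := ho.le_coupling hCD q hbq hqf hqs
  have hdm : Measurable fun p : X × X => ENNReal.ofReal (dist p.1 p.2 ^ 2) :=
    (measurable_dist.pow_const 2).ennreal_ofReal
  have hr1' : 0 < 1 - (r : ℝ) := by linarith
  have h2 : ∫⁻ p, ENNReal.ofReal (dist p.1 p.2 ^ 2) ∂q ≤
      ENNReal.ofReal (1 / r) * transportCost α' +
        ENNReal.ofReal (1 / (1 - r)) * (ENNReal.ofReal ((1 - r) ^ 2) * transportCost α) := by
    have c1 : transportCost α' = ∫⁻ p, ENNReal.ofReal (dist p.1.1 p.1.2 ^ 2) ∂Q := by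
      rw [cost_eq]
      have : ∫⁻ p, ENNReal.ofReal (dist p.1.1 p.1.2 ^ 2) ∂Q = ∫⁻ p, ENNReal.ofReal (dist p.1 p.2 ^ 2) ∂q1 := by
        rw [← hQ1, lintegral_map hdm measurable_fst]
      rw [this, hq1, lintegral_map hdm (mE 0 1)]
      rfl
    have c2 : ENNReal.ofReal ((1 - r) ^ 2) * transportCost α =
        ∫⁻ p, ENNReal.ofReal (dist p.1.2 p.2 ^ 2) ∂Q := by
      have : ∫⁻ p, ENNReal.ofReal (dist p.1.2 p.2 ^ 2) ∂Q = ∫⁻ p, ENNReal.ofReal (dist p.1 p.2 ^ 2) ∂q2 := by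
        rw [← hQ2, lintegral_map hdm hmid]
      rw [this, hq2, lintegral_map hdm (mE r 1), cost_eq,
        ← lintegral_const_mul _ (measurable_len.pow_const 2).ennreal_ofReal]
      congr 1; ext γ
      simp only
      rw [dist_eval, mul_pow, sq_abs, ← ENNReal.ofReal_mul (sq_nonneg _)]
      congr 2
      simp; ring
    rw [c2, c1, hq, lintegral_map hdm hout, ← lintegral_const_mul, ← lintegral_const_mul,
      ← lintegral_add_left]
    · apply lintegral_mono
      intro p
      simp only
      rw [← ENNReal.ofReal_mul (by positivity), ← ENNReal.ofReal_mul (by positivity),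
        ← ENNReal.ofReal_add (by positivity) (by positivity)]
      apply ENNReal.ofReal_le_ofReal
      have ht := dist_triangle p.1.1 p.1.2 p.2
      have h3 : dist p.1.1 p.2 ^ 2 ≤ (dist p.1.1 p.1.2 + dist p.1.2 p.2) ^ 2 :=
        pow_le_pow_left₀ dist_nonneg ht 2
      refine h3.trans ?_
      set x := dist p.1.1 p.1.2
      set y := dist p.1.2 p.2
      have : 1 / (r : ℝ) * x ^ 2 + 1 / (1 - (r : ℝ)) * y ^ 2 - (x + y) ^ 2 =
          ((1 - r) * x - r * y) ^ 2 / (r * (1 - r)) := by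
        field_simp; ring
      have : 0 ≤ ((1 - (r : ℝ)) * x - r * y) ^ 2 / (r * (1 - r)) := by positivity
      linarith
    · fun_prop
    · fun_prop
    · fun_prop
  have hfc := cost_lt_top hbb
  have hfc' : transportCost α' ≠ ⊤ :=
    cost_lt_top (Bdd.congr (hbb.rest 0 r) (by rw [e0, map_rest_zero]) (by rw [e1, map_rest_one]))
  rw [cost_rest]
  have h3 := h1.trans h2
  lift transportCost α to ℝ≥0 using hfc with a
  lift transportCost α' to ℝ≥0 using hfc' with b
  rw [← ENNReal.ofReal_coe_nnreal, ← ENNReal.ofReal_coe_nnreal, ← ENNReal.ofReal_mul (by positivity),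
    ← ENNReal.ofReal_mul (by positivity), ← ENNReal.ofReal_mul (by positivity),
    ← ENNReal.ofReal_add (by positivity) (by positivity),
    ENNReal.ofReal_le_ofReal_iff (by positivity)] at h3
  rw [← ENNReal.ofReal_coe_nnreal, ← ENNReal.ofReal_coe_nnreal, ← ENNReal.ofReal_mul (by positivity)]
  apply ENNReal.ofReal_le_ofReal
  have e : 1 / (1 - (r : ℝ)) * ((1 - r) ^ 2 * a) = (1 - r) * a := by field_simp
  rw [e] at h3
  have h4 : (r : ℝ) * a ≤ 1 / r * b := by linarith
  have h5 := mul_le_mul_of_nonneg_left h4 hr0.le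
  have e2 : (r : ℝ) * (1 / r * b) = b := by field_simp
  rw [e2] at h5
  simp only [Set.Icc.coe_zero, zero_sub, even_two, Even.neg_pow]
  nlinarith

lemma Opt.restr [SecondCountableTopology X] [CompleteSpace X]
    (hCD : IsCDStar K N m) {α : Measure (Geo X)} [IsFiniteMeasure α] (hb : Bdd α) (ho : Opt α)
    {a c : unitInterval} (hac : (a : ℝ) < c) : Opt (α.map (rest a c)) := by
  have hl : ∀ {β : Measure (Geo X)} (_ : IsFiniteMeasure β) (_ : Bdd β) (_ : Opt β) {r : unitInterval}
      (_ : 0 < (r : ℝ)), Opt (β.map (rest 0 r)) := by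
    intro β hf hb ho r hr
    rcases eq_or_lt_of_le r.2.2 with h | h
    · have : r = 1 := Subtype.ext h
      rw [this, map_rest_id]; exact ho
    · exact ho.rest_left hCD hb hr h
  have hc0 : 0 < (c : ℝ) := lt_of_le_of_lt a.2.1 hac
  have hfin : ∀ {β : Measure (Geo X)} (_ : IsFiniteMeasure β) (u v : unitInterval),
    IsFiniteMeasure (β.map (rest u v)) := fun _ _ _ => inferInstance
  set β := α.map (rest 0 c) with hβ
  have h1 : Opt β := hl inferInstance hb ho hc0
  have hbβ : Bdd β := hb.rest 0 c
  have hfβ : IsFiniteMeasure β := hfin inferInstance _ _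
  set s : unitInterval := ⟨1 - a / c, by
    have := (div_lt_one hc0).2 hac
    have h2 := div_nonneg a.2.1 hc0.le
    constructor <;> linarith⟩ with hs
  have hs0 : 0 < (s : ℝ) := by
    have := (div_lt_one hc0).2 hac
    simp only [hs]; linarith
  have h2 := (hl (hfin hfβ 1 0) (hbβ.rest 1 0) h1.rev hs0).rev
  rw [map_rest_rest, map_rest_rest, hβ, map_rest_rest] at h2
  convert h2 using 3
  · apply Subtype.ext
    simp only [affI_coe, hs, Set.Icc.coe_zero, Set.Icc.coe_one]
    field_simp
    ring
  · apply Subtype.ext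
    simp only [affI_coe, hs, Set.Icc.coe_zero, Set.Icc.coe_one]
    ring

end Restrict


section LemmaA

open Measure

lemma sigLow_ae {K n τ D : ℝ} {α : Measure (Geo X)} (hn : 1 ≤ n) (h0 : 0 ≤ τ) (h1 : τ ≤ 1)
    (hD : ∀ᵐ γ ∂α, len γ ≤ D) :
    ∀ᵐ γ ∂α, ENNReal.ofReal (sigLow K n τ D) ≤ sigmaCoeff K n τ (len γ) := by
  filter_upwards [hD] with γ hγ
  exact sigLow_le hn h0 h1 (len_nonneg γ) hγ

lemma rpow_core {s0 C M a : ℝ≥0∞} {n : ℝ} (hn : 1 < n) (hC0 : C ≠ 0) (hC : C ≠ ⊤) (ha : a ≠ ⊤)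
    (h : s0 * (C ^ (-(1 / n)) * a) ≤ M ^ (1 / n) * a ^ (1 - 1 / n)) : a * s0 ^ n ≤ C * M := by
  rcases eq_or_ne a 0 with rfl | ha0
  · simp
  have hn0 : 0 < n := by linarith
  have h2 := ENNReal.rpow_le_rpow h hn0.le
  have e1 : -(1 / n) * n = -1 := by field_simp
  have e2 : 1 / n * n = 1 := by field_simp
  have e3 : (1 - 1 / n) * n = n - 1 := by field_simp
  rw [ENNReal.mul_rpow_of_nonneg _ _ hn0.le, ENNReal.mul_rpow_of_nonneg _ _ hn0.le,
    ENNReal.mul_rpow_of_nonneg _ _ hn0.le, ← ENNReal.rpow_mul, ← ENNReal.rpow_mul,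
    ← ENNReal.rpow_mul, e1, e2, e3, ENNReal.rpow_one, ENNReal.rpow_neg_one] at h2
  have h3 : a ^ n = a * a ^ (n - 1) := by
    conv_rhs => rw [← ENNReal.rpow_one a, ENNReal.rpow_one a]
    nth_rw 2 [← ENNReal.rpow_one a]
    rw [← ENNReal.rpow_add _ _ ha0 ha]; congr 1; ring
  have hz : a ^ (n - 1) ≠ 0 := by
    simp [ENNReal.rpow_eq_zero_iff, ha0, ha]
  have ht : a ^ (n - 1) ≠ ⊤ := by
    simp [ENNReal.rpow_eq_top_iff, ha0, ha]
  have h4 : (s0 ^ n * (C⁻¹ * a)) * a ^ (n - 1) ≤ M * a ^ (n - 1) := by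
    rw [h3] at h2
    calc _ = s0 ^ n * (C⁻¹ * (a * a ^ (n - 1))) := by ring
      _ ≤ _ := h2
  have h5 := (ENNReal.mul_le_mul_iff_left hz ht).1 h4
  calc a * s0 ^ n = C * (s0 ^ n * (C⁻¹ * a)) := by
        rw [show C * (s0 ^ n * (C⁻¹ * a)) = (C * C⁻¹) * (a * s0 ^ n) by ring,
          ENNReal.mul_inv_cancel hC0 hC, one_mul]
    _ ≤ _ := by gcongr

variable [BorelSpace X] {K N : ℝ} {m : Measure X} [SigmaFinite m]

lemma CDineq.core {β : Measure (Geo X)} [IsFiniteMeasure β] (h : CDineq K N m β) {C : ℝ≥0∞}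
    (hC0 : C ≠ 0) (hC : C ≠ ⊤) (hle : β.map (eval 0) ≤ C • m) {n : ℝ} (hNn : N ≤ n) (hn : 1 < n)
    {D : ℝ} (hD : ∀ᵐ γ ∂β, len γ ≤ D) {t : unitInterval} {E : Set X} (hE : MeasurableSet E)
    (hβE : (β.map (eval t)) Eᶜ = 0) :
    β univ * ENNReal.ofReal (sigLow K n (1 - t) D) ^ n ≤ C * m E := by
  have hac : β.map (eval 0) ≪ m := (absolutelyContinuous_of_le hle).trans smul_absolutelyContinuous
  have h1 := h t n hNn hn _ 0 (sigLow_ae hn.le (by linarith [t.2.2]) (by linarith [t.2.1]) hD)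
    (by simp) (Or.inr hac) (Or.inl rfl)
  have h2 := Fent_lower (m := m) (p_lt hn) _ hC0 hC hle
  have h3 := Fent_holder (m := m) (p_pos hn) (p_lt hn) _ hE hβE
  rw [map_apply (measurable_eval _) .univ, preimage_univ, _root_.sub_sub_cancel] at h2 h3
  apply rpow_core hn hC0 hC (measure_ne_top _ _)
  rw [zero_mul, add_zero] at h1
  calc _ ≤ _ := by gcongr
    _ ≤ _ := h1
    _ ≤ _ := h3

/-- L1a -/
lemma CDineq.not_sing {β : Measure (Geo X)} [IsFiniteMeasure β] (h : CDineq K N m β) (hN : 1 ≤ N)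
    {C : ℝ≥0∞} (hC0 : C ≠ 0) (hC : C ≠ ⊤) (hle : β.map (eval 0) ≤ C • m) (hb : Bdd β)
    (h0 : β ≠ 0) {t : unitInterval} (ht : (t : ℝ) < 1) : ¬ (β.map (eval t)) ⟂ₘ m := by
  obtain ⟨D, hD0, hD⟩ := hb.len_le
  have hn : 1 < N + 1 := by linarith
  have hac : β.map (eval 0) ≪ m := (absolutelyContinuous_of_le hle).trans smul_absolutelyContinuous
  have h1 := h t (N + 1) (by linarith) hn _ 0
    (sigLow_ae hn.le (by linarith [t.2.2]) (by linarith [t.2.1]) hD)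
    (by simp) (Or.inr hac) (Or.inl rfl)
  have h2 := Fent_lower (m := m) (p_lt hn) _ hC0 hC hle
  rw [map_apply (measurable_eval _) .univ, preimage_univ, _root_.sub_sub_cancel] at h2
  rw [zero_mul, add_zero] at h1
  apply Fent_ne_zero (p_pos hn)
  have h3 : 0 < ENNReal.ofReal (sigLow K (N + 1) (1 - t) D) :=
    ENNReal.ofReal_pos.2 (sigLow_pos hn.le (by linarith) hD0.le)
  have h4 : 0 < C ^ (-(1 / (N + 1))) := ENNReal.rpow_pos (pos_iff_ne_zero.2 hC0) hC
  have h5 : 0 < β univ := by simpa [pos_iff_ne_zero] using h0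
  have h6 : 0 < ENNReal.ofReal (sigLow K (N + 1) (1 - t) D) * (C ^ (-(1 / (N + 1))) * β univ) :=
    ENNReal.mul_pos h3.ne' (ENNReal.mul_pos h4.ne' h5.ne').ne'
  exact (h6.trans_le ((mul_le_mul_right h2 _).trans h1)).ne'

lemma map_le_map {α β : Measure (Geo X)} (h : α ≤ β) (t : unitInterval) :
    α.map (eval t) ≤ β.map (eval t) := Measure.map_mono h (measurable_eval t)

/-- Lemma A -/
lemma lemmaA (hCD : IsCDStar K N m) (hGT : GoodTransport m) {α : Measure (Geo X)}
    [IsFiniteMeasure α] (hb : Bdd α) (ho : Opt α) {C : ℝ≥0∞} (hC0 : C ≠ 0) (hC : C ≠ ⊤)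
    (hle : α.map (eval 0) ≤ C • m) (a1 : α.map (eval 1) ≪ m) {n : ℝ} (hNn : N ≤ n) (hn : 1 < n)
    {D : ℝ} (hD : ∀ᵐ γ ∂α, len γ ≤ D) (t : unitInterval) {E : Set X} (hE : MeasurableSet E) :
    (α.map (eval t)) E * ENNReal.ofReal (sigLow K n (1 - t) D) ^ n ≤ C * m E := by
  set β := α.restrict (eval t ⁻¹' E) with hβ
  have hβα : β ≤ α := restrict_le_self
  have hacβ := absolutelyContinuous_of_le hβα
  have hle' := (map_le_map hβα 0).trans hle
  have hcd : CDineq K N m β := cd_of_opt hCD hGT (hb.mono hacβ) (ho.mono hb hβα)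
    ((absolutelyContinuous_of_le hle').trans smul_absolutelyContinuous)
    ((hacβ.map (measurable_eval 1)).trans a1)
  have := hcd.core hC0 hC hle' hNn hn (hacβ.ae_le hD) (t := t) hE (by
    rw [map_apply (measurable_eval t) hE.compl, hβ,
      restrict_apply (measurable_eval t hE.compl)]
    rw [preimage_compl, compl_inter_self, measure_empty])
  rw [hβ, restrict_apply_univ] at this
  rwa [map_apply (measurable_eval t) hE]

lemma lemmaA_ac (hN : 1 ≤ N) (hCD : IsCDStar K N m) (hGT : GoodTransport m) {α : Measure (Geo X)}
    [IsFiniteMeasure α] (hb : Bdd α) (ho : Opt α) {C : ℝ≥0∞} (hC0 : C ≠ 0) (hC : C ≠ ⊤)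
    (hle : α.map (eval 0) ≤ C • m) (a1 : α.map (eval 1) ≪ m) (t : unitInterval) :
    α.map (eval t) ≪ m := by
  rcases eq_or_lt_of_le t.2.2 with h | h
  · have : t = 1 := Subtype.ext h
    rw [this]; exact a1
  obtain ⟨D, hD0, hD⟩ := hb.len_le
  have hn : 1 < N + 1 := by linarith
  refine AbsolutelyContinuous.mk fun E hE hz => ?_
  have := lemmaA hCD hGT hb ho hC0 hC hle a1 (n := N + 1) (by linarith) hn hD t hE
  rw [hz, mul_zero, nonpos_iff_eq_zero, mul_eq_zero] at this
  rcases this with h1 | h1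
  · exact h1
  · exfalso
    rw [ENNReal.rpow_eq_zero_iff] at h1
    have h3 : 0 < ENNReal.ofReal (sigLow K (N + 1) (1 - t) D) :=
      ENNReal.ofReal_pos.2 (sigLow_pos hn.le (by linarith) hD0.le)
    rcases h1 with h1 | h1
    · exact h3.ne' h1.1
    · exact ENNReal.ofReal_ne_top h1.1

end LemmaA


section NB

open Measure

variable [BorelSpace X] {K N : ℝ} {m : Measure X} [SigmaFinite m]

lemma cd_win [SecondCountableTopology X] [CompleteSpace X]
    (hCD : IsCDStar K N m) (hGT : GoodTransport m) {α : Measure (Geo X)}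
    [IsFiniteMeasure α] (hb : Bdd α) (ho : Opt α) (hac : ∀ t, α.map (eval t) ≪ m)
    {n : ℝ} (hNn : N ≤ n) (hn : 1 < n) {D D' : ℝ} (hD : ∀ᵐ γ ∂α, len γ ≤ D)
    {a c : unitInterval} (hlt : (a : ℝ) < c) (hD' : ((c : ℝ) - a) * D ≤ D') (u : unitInterval) :
    ENNReal.ofReal (sigLow K n (1 - u) D') * Fent m (1 - 1 / n) (α.map (eval a)) +
    ENNReal.ofReal (sigLow K n u D') * Fent m (1 - 1 / n) (α.map (eval c)) ≤
      Fent m (1 - 1 / n) (α.map (eval (affI a c u))) := by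
  have hcd : CDineq K N m (α.map (rest a c)) := cd_of_opt hCD hGT (hb.rest a c)
    (ho.restr hCD hb hlt) (by rw [map_rest_zero]; exact hac _) (by rw [map_rest_one]; exact hac _)
  have hl : ∀ᵐ γ ∂(α.map (rest a c)), len γ ≤ D' := by
    have hms : MeasurableSet {γ : Geo X | len γ ≤ D'} := measurable_len measurableSet_Iic
    rw [ae_map_iff (measurable_rest a c).aemeasurable hms]
    filter_upwards [hD] with γ hγ
    rw [len_rest, abs_sub_comm, abs_of_pos (by linarith)]
    exact (mul_le_mul_of_nonneg_left hγ (by linarith)).trans hD'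
  have h0 := u.2.1
  have h1 := u.2.2
  have := hcd u n hNn hn _ _ (sigLow_ae hn.le (by linarith) (by linarith) hl)
    (sigLow_ae hn.le h0 h1 hl) (Or.inr (by rw [map_rest_zero]; exact hac _))
    (Or.inr (by rw [map_rest_one]; exact hac _))
  rwa [map_rest_zero, map_rest_one, map_rest_eval] at this

lemma Fent_pos {μ : Measure X} [IsFiniteMeasure μ] (h : μ ≪ m) (h0 : μ ≠ 0) {p : ℝ} (hp : 0 < p) :
    Fent m p μ ≠ 0 := by
  intro hz
  unfold Fent at hz
  rw [lintegral_eq_zero_iff ((measurable_rnDeriv _ _).pow_const p)] at hz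
  apply h0
  rw [← Measure.measure_univ_eq_zero, ← lintegral_rnDeriv h, lintegral_eq_zero_iff (measurable_rnDeriv _ _)]
  filter_upwards [hz] with x hx
  simpa [ENNReal.rpow_eq_zero_iff, hp, not_lt.2 hp.le] using hx

lemma Bdd.eval_ball {α : Measure (Geo X)} (h : Bdd α) :
    ∃ (x0 : X) (R : ℝ), ∀ t : unitInterval, (α.map (eval t)) (closedBall x0 R)ᶜ = 0 := by
  obtain ⟨x0, R, hR, h⟩ := h
  refine ⟨x0, 3 * R, fun t => ?_⟩
  rw [map_apply (measurable_eval t) measurableSet_closedBall.compl]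
  have key : ∀ᵐ γ ∂α, dist (eval t γ) x0 ≤ 3 * R := by
    filter_upwards [h] with γ hγ
    have h1 := dist_triangle_right (eval 0 γ) (eval 1 γ) x0
    have h2 := dist_triangle (eval t γ) (eval 0 γ) x0
    have h3 := dist_eval t 0 γ
    have h4 : |(t : ℝ) - (0 : unitInterval)| ≤ 1 := by
      rw [abs_le]; constructor <;> simp <;> linarith [t.2.1, t.2.2]
    have h5 := mul_le_mul_of_nonneg_right h4 (len_nonneg γ)
    have : len γ ≤ 2 * R := by unfold len; linarith [hγ.1, hγ.2]
    linarith [hγ.1]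
  refine measure_mono_null ?_ key
  intro γ hγ; simpa using hγ

lemma Fent_ne_top (hm : ∀ s : Set X, Bornology.IsBounded s → m s ≠ ⊤) {α : Measure (Geo X)}
    [IsFiniteMeasure α] (h : Bdd α) {p : ℝ} (hp0 : 0 < p) (hp1 : p < 1) (t : unitInterval) :
    Fent m p (α.map (eval t)) ≠ ⊤ := by
  obtain ⟨x0, R, h⟩ := h.eval_ball
  refine ne_top_of_le_ne_top ?_ (Fent_holder (m := m) hp0 hp1 _ measurableSet_closedBall (h t))
  apply ENNReal.mul_ne_top
  · exact ENNReal.rpow_ne_top_of_nonneg (by linarith) (hm _ isBounded_closedBall)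
  · exact ENNReal.rpow_ne_top_of_nonneg hp0.le (measure_ne_top _ _)

lemma nb_step [SecondCountableTopology X] [CompleteSpace X]
    (hm : ∀ s : Set X, Bornology.IsBounded s → m s ≠ ⊤)
    (hCD : IsCDStar K N m) (hGT : GoodTransport m) {A B : Measure (Geo X)}
    [IsFiniteMeasure A] [IsFiniteMeasure B] (hb : Bdd (A + B)) (ho : Opt (A + B))
    (hac : ∀ t, (A + B).map (eval t) ≪ m)
    {n : ℝ} (hNn : N ≤ n) (hn : 1 < n) {D : ℝ} (hD0 : 0 ≤ D) (hD : ∀ᵐ γ ∂(A + B), len γ ≤ D)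
    {a b c : unitInterval} {h : ℝ} (hh : 0 < h) (hab : (a : ℝ) = b - h) (hcb : (c : ℝ) = b + h)
    (hc1 : (c : ℝ) < 1) (heq : A.map (eval b) = B.map (eval b)) (hne : A.map (eval b) ≠ 0)
    {k1 k2 k3 : ℝ≥0∞} (hk1 : k1 ≤ ENNReal.ofReal (sigLow K n (1 - h / b) D))
    (hk2 : k2 ≤ ENNReal.ofReal (sigLow K n (1 - h / (1 - b)) D))
    (hk3 : k3 ≤ ENNReal.ofReal (sigLow K n (1 / 2) (2 * h * D)))
    (hk : (2 : ℝ≥0∞) ^ (1 - 1 / n) < k3 * (2 ^ (1 - 1 / n) * k1 + 2 * k2)) :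
    ¬ (A.map (eval c)) ⟂ₘ (B.map (eval c)) := by
  intro hs
  have hp0 := p_pos hn
  have hp1 := p_lt hn
  have ha0 := a.2.1
  have hb0 : 0 < (b : ℝ) := by linarith
  have hAle : A ≤ A + B := Measure.le_add_right le_rfl
  have hBle : B ≤ A + B := Measure.le_add_left le_rfl
  have sub : ∀ Z : Measure (Geo X), IsFiniteMeasure Z → Z ≤ A + B →
      k1 * Fent m (1 - 1 / n) (Z.map (eval b)) ≤ Fent m (1 - 1 / n) (Z.map (eval a)) ∧
      k2 * Fent m (1 - 1 / n) (Z.map (eval b)) ≤ Fent m (1 - 1 / n) (Z.map (eval c)) := by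
    intro Z hZ hle
    have hacZ := absolutelyContinuous_of_le hle
    have hbZ := hb.mono hacZ
    have hoZ := ho.mono hb hle
    have haZ : ∀ t, Z.map (eval t) ≪ m := fun t => (hacZ.map (measurable_eval t)).trans (hac t)
    have hDZ := hacZ.ae_le hD
    constructor
    · have hu : (0 : ℝ) ≤ 1 - h / b ∧ 1 - h / (b : ℝ) ≤ 1 := by
        have e : h / (b : ℝ) ≤ 1 := (div_le_one hb0).2 (by linarith)
        have e' : 0 ≤ h / (b : ℝ) := by positivity
        constructor <;> linarith
      have h1 := cd_win hCD hGT hbZ hoZ haZ hNn hn hDZ (a := 0) (c := b) (D' := D) (by simpa using hb0)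
        (by
          have := b.2.2
          simp; nlinarith) ⟨1 - h / b, hu⟩
      have e : affI 0 b ⟨1 - h / b, hu⟩ = a := by
        apply Subtype.ext
        simp only [affI_coe, hab, Set.Icc.coe_zero]
        field_simp
        ring
      rw [e] at h1
      refine le_trans ?_ ((self_le_add_left _ _).trans h1)
      gcongr
    · have hb1 : 0 < 1 - (b : ℝ) := by linarith
      have hu : (0 : ℝ) ≤ h / (1 - b) ∧ h / (1 - (b : ℝ)) ≤ 1 := by
        have e : h / (1 - (b : ℝ)) ≤ 1 := (div_le_one hb1).2 (by linarith)
        have e' : 0 ≤ h / (1 - (b : ℝ)) := by positivity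
        constructor <;> linarith
      have h1 := cd_win hCD hGT hbZ hoZ haZ hNn hn hDZ (a := b) (c := 1) (D' := D) 
        (by simpa using (by linarith : (b : ℝ) < 1))
        (by
          have := b.2.1
          simp; nlinarith) ⟨h / (1 - b), hu⟩
      have e : affI b 1 ⟨h / (1 - b), hu⟩ = c := by
        apply Subtype.ext
        simp only [affI_coe, hcb, Set.Icc.coe_one]
        field_simp
        ring
      rw [e] at h1
      refine le_trans ?_ ((self_le_add_right _ _).trans h1)
      gcongr
  obtain ⟨A1, A2⟩ := sub A inferInstance hAle
  obtain ⟨B1, B2⟩ := sub B inferInstance hBle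
  rw [← heq] at B1 B2
  have hu : (0 : ℝ) ≤ 1 / 2 ∧ (1 : ℝ) / 2 ≤ 1 := by norm_num
  have h3 := cd_win hCD hGT hb ho hac hNn hn hD (a := a) (c := c) (D' := 2 * h * D) (by linarith)
    (by rw [hab, hcb]; exact le_of_eq (by ring)) ⟨1 / 2, hu⟩
  have e : affI a c ⟨1 / 2, hu⟩ = b := by
    apply Subtype.ext
    simp only [affI_coe, hab, hcb]
    ring
  rw [e] at h3
  have hhalf : (1 : ℝ) - 1 / 2 = 1 / 2 := by norm_num
  simp only [hhalf] at h3
  rw [← mul_add] at h3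
  simp only [Measure.map_add _ _ (measurable_eval _)] at h3
  rw [← Fent_add_sing hp0 _ _ hs, ← heq, ← two_smul ℝ≥0∞ (A.map (eval b)),
    Fent_smul hp0 _ ENNReal.ofNat_ne_top] at h3
  have h4 := Fent_add_half (m := m) hp0 hp1 (A.map (eval a)) (B.map (eval a))
  set x := Fent m (1 - 1 / n) (A.map (eval b)) with hx
  set p := 1 - 1 / n with hp
  have hx0 : x ≠ 0 := Fent_pos (((absolutelyContinuous_of_le hAle).map (measurable_eval b)).trans (hac b)) hne hp0
  have hxt : x ≠ ⊤ := Fent_ne_top hm (hb.mono (absolutelyContinuous_of_le hAle)) hp0 hp1 b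
  have h5 : 2 ^ p * k1 * x ≤ Fent m p (A.map (eval a) + B.map (eval a)) := by
    have e1 : (2 : ℝ≥0∞) ^ p = 2 ^ (p - 1) * 2 := by
      nth_rw 3 [← ENNReal.rpow_one 2]
      rw [← ENNReal.rpow_add _ _ (by norm_num) (by norm_num)]; congr 1; ring
    have e2 : (2 : ℝ≥0∞) ^ (p - 1) * 2 ^ (1 - p) = 1 := by
      rw [← ENNReal.rpow_add _ _ (by norm_num) (by norm_num)]
      simp
    calc 2 ^ p * k1 * x = 2 ^ (p - 1) * (k1 * x + k1 * x) := by rw [e1]; ring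
      _ ≤ 2 ^ (p - 1) * (2 ^ (1 - p) * Fent m p (A.map (eval a) + B.map (eval a))) := by
          gcongr 2 ^ (p - 1) * ?_
          exact (add_le_add A1 B1).trans h4
      _ = _ := by rw [← mul_assoc, e2, one_mul]
  have h6 : k3 * (2 ^ p * k1 + 2 * k2) * x ≤ 2 ^ p * x := by
    calc k3 * (2 ^ p * k1 + 2 * k2) * x = k3 * (2 ^ p * k1 * x + (k2 * x + k2 * x)) := by ring
      _ ≤ _ := by
        refine le_trans ?_ h3
        gcongr
  have h7 := (ENNReal.mul_le_mul_iff_left hx0 hxt).1 h6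
  exact absurd hk (not_lt.2 h7)

open Filter Topology in
lemma nb_const {K n s v D : ℝ} (hn : 1 < n) (hs : 0 < s) (hv : v < 1) (hD : 0 < D) :
    ∃ h : ℝ, 0 < h ∧ h < s ∧ h < 1 - v ∧ (2 : ℝ≥0∞) ^ (1 - 1 / n) <
      ENNReal.ofReal (sigLow K n (1 / 2) (2 * h * D)) *
        (2 ^ (1 - 1 / n) * ENNReal.ofReal (sigLow K n (1 - h / s) D) +
          2 * ENNReal.ofReal (sigLow K n (1 - h / (1 - v)) D)) := by
  set p := 1 - 1 / n with hp
  have t1 : ∀ w : ℝ, 0 < w → Tendsto (fun h : ℝ => ENNReal.ofReal (sigLow K n (1 - h / w) D))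
      (𝓝[>] 0) (𝓝 1) := by
    intro w hw
    have : Tendsto (fun h : ℝ => 1 - h / w) (𝓝[>] 0) (𝓝 1) := by
      have : Tendsto (fun h : ℝ => 1 - h / w) (𝓝[>] 0) (𝓝 (1 - 0 / w)) :=
        (Continuous.tendsto (by fun_prop) 0).mono_left nhdsWithin_le_nhds
      simpa using this
    have h2 := sigLow_tendsto (K := K) (D := D) hn.le hD.le tendsto_const_nhds this
    rw [sigLow_one hn.le hD.le] at h2
    have h3 := (ENNReal.continuous_ofReal.tendsto _).comp h2
    rw [ENNReal.ofReal_one] at h3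
    exact h3
  have t3 : Tendsto (fun h : ℝ => ENNReal.ofReal (sigLow K n (1 / 2) (2 * h * D)))
      (𝓝[>] 0) (𝓝 (ENNReal.ofReal (1 / 2))) := by
    apply (ENNReal.continuous_ofReal.tendsto _).comp
    apply (sigLow_half_tendsto hn.le).comp
    rw [tendsto_nhdsWithin_iff]
    constructor
    · have : Tendsto (fun h : ℝ => 2 * h * D) (𝓝[>] 0) (𝓝 (2 * 0 * D)) :=
        (Continuous.tendsto (by fun_prop) 0).mono_left nhdsWithin_le_nhds
      simpa using this
    · filter_upwards [self_mem_nhdsWithin] with h hh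
      have : (0 : ℝ) < h := hh
      exact mem_Ioi.2 (by positivity)
  have h2p : (2 : ℝ≥0∞) ^ p ≠ ⊤ := by simp [ENNReal.rpow_eq_top_iff]
  have lim : Tendsto (fun h : ℝ => ENNReal.ofReal (sigLow K n (1 / 2) (2 * h * D)) *
        (2 ^ p * ENNReal.ofReal (sigLow K n (1 - h / s) D) +
          2 * ENNReal.ofReal (sigLow K n (1 - h / (1 - v)) D))) (𝓝[>] 0)
      (𝓝 (ENNReal.ofReal (1 / 2) * (2 ^ p * 1 + 2 * 1))) := by
    apply ENNReal.Tendsto.mul t3 (Or.inr ?_) _ (Or.inr ENNReal.ofReal_ne_top)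
    · simp [h2p]
    · exact (ENNReal.Tendsto.const_mul (t1 s hs) (Or.inr h2p)).add
        (ENNReal.Tendsto.const_mul (t1 _ (by linarith)) (Or.inr ENNReal.ofNat_ne_top))
  have hlt : (2 : ℝ≥0∞) ^ p < ENNReal.ofReal (1 / 2) * (2 ^ p * 1 + 2 * 1) := by
    have h1 : (2 : ℝ≥0∞) ^ p < 2 := by
      nth_rw 2 [← ENNReal.rpow_one 2]
      exact ENNReal.rpow_lt_rpow_of_exponent_lt (by norm_num) (by norm_num) (p_lt hn)
    have e : ENNReal.ofReal (1 / 2) = 2⁻¹ := by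
      rw [one_div, ENNReal.ofReal_inv_of_pos (by norm_num)]; simp
    rw [e, mul_one, mul_one]
    calc (2 : ℝ≥0∞) ^ p = 2⁻¹ * (2 ^ p + 2 ^ p) := by
          rw [← two_mul, ← mul_assoc, ENNReal.inv_mul_cancel (by norm_num) (by norm_num), one_mul]
      _ < _ := by
          apply (ENNReal.mul_lt_mul_iff_right (by norm_num) (by norm_num)).2
          exact (ENNReal.add_lt_add_iff_left h2p).2 h1
  have ev := lim.eventually (lt_mem_nhds hlt)
  have ev2 : ∀ᶠ h : ℝ in 𝓝[>] 0, 0 < h ∧ h < s ∧ h < 1 - v := by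
    filter_upwards [Ioo_mem_nhdsGT (show (0 : ℝ) < min s (1 - v) from lt_min hs (by linarith))] with h hh
    exact ⟨hh.1, (lt_min_iff.1 hh.2).1, (lt_min_iff.1 hh.2).2⟩
  obtain ⟨h, h1, h2⟩ := (ev.and ev2).exists
  exact ⟨h, h2.1, h2.2.1, h2.2.2, h1⟩

lemma inf_ne_zero {Z : Type*} [MeasurableSpace Z] {μ ν : Measure Z} (h : ¬ μ ⟂ₘ ν)
    [SigmaFinite μ] [SigmaFinite ν] : μ ⊓ ν ≠ 0 := by
  intro h0
  apply h
  rw [Measure.mutuallySingular_iff_disjoint, disjoint_iff]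
  exact h0

/-- propagation of overlap -/
lemma nb_prop [SecondCountableTopology X] [CompleteSpace X] (hN : 1 ≤ N)
    (hm : ∀ s : Set X, Bornology.IsBounded s → m s ≠ ⊤)
    (hCD : IsCDStar K N m) (hGT : GoodTransport m) {A B : Measure (Geo X)}
    [IsFiniteMeasure A] [IsFiniteMeasure B] (hb : Bdd (A + B)) (ho : Opt (A + B))
    (hac : ∀ t, (A + B).map (eval t) ≪ m) {s : unitInterval} (hs : 0 < (s : ℝ))
    (hov : ¬ (A.map (eval s)) ⟂ₘ (B.map (eval s))) {v : ℝ} (hv : v < 1) (hsv : (s : ℝ) ≤ v) :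
    ∃ c : unitInterval, v ≤ c ∧ ¬ (A.map (eval c)) ⟂ₘ (B.map (eval c)) := by
  obtain ⟨D, hD0, hD⟩ := hb.len_le
  have hn : 1 < N + 1 := by linarith
  obtain ⟨h, hh, hhs, hhv, hk⟩ := nb_const (K := K) hn hs hv hD0
  have step : ∀ b c : unitInterval, (s : ℝ) ≤ b → (b : ℝ) ≤ v → (c : ℝ) = b + h →
      ¬ (A.map (eval b)) ⟂ₘ (B.map (eval b)) → ¬ (A.map (eval c)) ⟂ₘ (B.map (eval c)) := by
    intro b c hsb hbv hcb hov hsing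
    have hη := inf_ne_zero hov
    obtain ⟨A', hA', eA⟩ := exists_lift A (measurable_eval b) (η := A.map (eval b) ⊓ B.map (eval b)) inf_le_left
    obtain ⟨B', hB', eB⟩ := exists_lift B (measurable_eval b) (η := A.map (eval b) ⊓ B.map (eval b)) inf_le_right
    have hfA : IsFiniteMeasure A' := isFiniteMeasure_of_le _ hA'
    have hfB : IsFiniteMeasure B' := isFiniteMeasure_of_le _ hB'
    have hle : A' + B' ≤ A + B := add_le_add hA' hB'
    have hacc := absolutelyContinuous_of_le hle
    have hb0 : 0 < (b : ℝ) := by linarith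
    refine nb_step hm hCD hGT (hb.mono hacc) (ho.mono hb hle)
      (fun t => (hacc.map (measurable_eval t)).trans (hac t)) (n := N + 1) (by linarith) hn hD0.le
      (hacc.ae_le hD) (a := ⟨b - h, by constructor <;> linarith [b.2.2]⟩) (b := b) (c := c) hh rfl hcb
      (by linarith) (eA.trans eB.symm) (by rw [eA]; exact hη) (k1 := _) (k2 := _) (k3 := _)
      ?_ ?_ le_rfl hk ?_
    · apply ENNReal.ofReal_le_ofReal
      apply sigLow_mono hD0.le
      gcongr
    · apply ENNReal.ofReal_le_ofReal
      apply sigLow_mono hD0.le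
      have : 0 < 1 - v := by linarith
      gcongr
    · exact (hsing.mono_ac ((absolutelyContinuous_of_le hA').map (measurable_eval c))
        ((absolutelyContinuous_of_le hB').map (measurable_eval c)))
  by_contra hcon
  push Not at hcon
  have all : ∀ j : ℕ, ∃ b : unitInterval, (b : ℝ) = s + j * h ∧
      ¬ (A.map (eval b)) ⟂ₘ (B.map (eval b)) := by
    intro j
    induction j with
    | zero => exact ⟨s, by simp, hov⟩
    | succ j ih =>
      obtain ⟨b, hb, hob⟩ := ih
      have hbv : (b : ℝ) < v := by
        by_contra hle
        exact hob (hcon b (not_lt.1 hle))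
      have hjh : 0 ≤ (j : ℝ) * h := by positivity
      refine ⟨⟨b + h, by constructor <;> linarith⟩, by push_cast; rw [hb]; ring, ?_⟩
      exact step b _ (by linarith) hbv.le rfl hob
  obtain ⟨j, hj⟩ := exists_nat_gt (1 / h)
  obtain ⟨b, hb, -⟩ := all j
  have := (div_lt_iff₀ hh).1 hj
  linarith [b.2.2]

end NB


section Sep

open Measure

variable [BorelSpace X] {K N : ℝ} {m : Measure X} [SigmaFinite m]

lemma exists_compact_density [ProperSpace X] [IsFiniteMeasureOnCompacts m]
    {η : Measure X} [IsFiniteMeasure η] (hac : η ≪ m) (h0 : η ≠ 0) :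
    ∃ (Q : Set X) (k : ℝ≥0∞), IsCompact Q ∧ m Q ≠ 0 ∧ k ≠ 0 ∧ k ≠ ⊤ ∧ m.restrict Q ≤ k • η := by
  set ρ := η.rnDeriv m with hρ
  have hρm : Measurable ρ := measurable_rnDeriv _ _
  have hex : ∃ k : ℕ, m {x | ((k : ℝ≥0∞) + 1)⁻¹ ≤ ρ x} ≠ 0 := by
    by_contra hcon
    push Not at hcon
    apply h0
    rw [← Measure.measure_univ_eq_zero, ← lintegral_rnDeriv hac, lintegral_eq_zero_iff hρm]
    have : ∀ᵐ x ∂m, ∀ k : ℕ, ρ x < ((k : ℝ≥0∞) + 1)⁻¹ := by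
      rw [ae_all_iff]
      intro k
      have := hcon k
      rw [ae_iff]
      simpa using this
    filter_upwards [this] with x hx
    by_contra hne
    obtain ⟨k, hk⟩ := ENNReal.exists_inv_nat_lt (a := ρ x) hne
    have h1 := hx k
    have h2 : ((k : ℝ≥0∞) + 1)⁻¹ ≤ (k : ℝ≥0∞)⁻¹ := ENNReal.inv_le_inv.2 (by simp)
    exact absurd (h1.trans_le h2) (not_lt.2 hk.le)
  obtain ⟨k, hk⟩ := hex
  set S := {x | ((k : ℝ≥0∞) + 1)⁻¹ ≤ ρ x} with hS
  have hSm : MeasurableSet S := measurableSet_le measurable_const hρm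
  have hk0 : (k : ℝ≥0∞) + 1 ≠ 0 := by simp
  have hkt : (k : ℝ≥0∞) + 1 ≠ ⊤ := by simp
  have hle : m.restrict S ≤ ((k : ℝ≥0∞) + 1) • η := by
    rw [Measure.le_iff]
    intro s hs
    rw [restrict_apply hs]
    have h1 : ∫⁻ x in s ∩ S, ((k : ℝ≥0∞) + 1)⁻¹ ∂m ≤ ∫⁻ x in s ∩ S, ρ x ∂m := by
      apply setLIntegral_mono hρm
      intro x hx
      exact hx.2
    rw [setLIntegral_const] at h1
    have h2 : ∫⁻ x in s ∩ S, ρ x ∂m ≤ η s :=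
      (setLIntegral_rnDeriv_le _).trans (measure_mono inter_subset_left)
    rw [Measure.smul_apply, smul_eq_mul]
    calc m (s ∩ S) = ((k : ℝ≥0∞) + 1) * (((k : ℝ≥0∞) + 1)⁻¹ * m (s ∩ S)) := by
          rw [← mul_assoc, ENNReal.mul_inv_cancel hk0 hkt, one_mul]
      _ ≤ _ := by gcongr; exact h1.trans h2
  have hfin : m S ≠ ⊤ := by
    have := hle univ
    rw [restrict_apply_univ] at this
    exact ne_top_of_le_ne_top (ENNReal.mul_ne_top hkt (measure_ne_top _ _)) this
  obtain ⟨Q, hQS, hQ, hlt⟩ := hSm.exists_lt_isCompact_of_ne_top hfin (pos_iff_ne_zero.2 hk)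
  exact ⟨Q, _, hQ, hlt.ne', hk0, hkt, (restrict_mono hQS le_rfl).trans hle⟩

open Filter Topology in
/-- Gigli's start -/
lemma start_overlap [ProperSpace X] [IsFiniteMeasureOnCompacts m] (hN : 1 ≤ N)
    (hCD : IsCDStar K N m) (hGT : GoodTransport m) {A B : Measure (Geo X)}
    [IsFiniteMeasure A] [IsFiniteMeasure B] (hbA : Bdd A) (hbB : Bdd B) (hoA : Opt A) (hoB : Opt B)
    (hac0 : A.map (eval 0) ≪ m) (hA1 : A.map (eval 1) ≪ m) (hB1 : B.map (eval 1) ≪ m)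
    (heq : A.map (eval 0) = B.map (eval 0)) (hne : A ≠ 0) {v : ℝ} (hv : 0 < v) (hv1 : v < 1) :
    ∃ s : unitInterval, 0 < (s : ℝ) ∧ (s : ℝ) ≤ v ∧ ¬ (A.map (eval s)) ⟂ₘ (B.map (eval s)) := by
  by_contra hcon
  push Not at hcon
  have hne0 : A.map (eval 0) ≠ 0 := by
    rwa [Ne, Measure.map_eq_zero_iff (measurable_eval 0).aemeasurable]
  obtain ⟨Q, k, hQ, hQ0, hk0, hkt, hle⟩ := exists_compact_density hac0 hne0
  have hQm : MeasurableSet Q := hQ.isClosed.measurableSet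
  have hQt : m Q ≠ ⊤ := hQ.measure_lt_top.ne
  obtain ⟨D, hD0, hDA⟩ := hbA.len_le
  obtain ⟨D', hD0', hDB⟩ := hbB.len_le
  set D1 := max D D' with hD1
  have hD10 : 0 < D1 := lt_max_of_lt_left hD0
  have hn : 1 < N + 1 := by linarith
  have sub : ∀ Z : Measure (Geo X), IsFiniteMeasure Z → Bdd Z → Opt Z → Z.map (eval 1) ≪ m →
      Z.map (eval 0) = A.map (eval 0) → (∀ᵐ γ ∂Z, len γ ≤ D1) → ∃ Z' : Measure (Geo X), Z' ≪ Z ∧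
      ∀ (s : unitInterval) (S : Set X), MeasurableSet S → (Z'.map (eval s)) S = 0 →
        m Q * ENNReal.ofReal (sigLow K (N + 1) (1 - s) D1) ^ (N + 1) ≤
          m (cthickening (s * D1) Q ∩ Sᶜ) := by
    intro Z hf hb ho h1 h0 hDZ
    have hfk : IsFiniteMeasure (k • Z) := Measure.smul_finite Z hkt
    obtain ⟨Z', hZ', eZ⟩ := exists_lift (k • Z) (measurable_eval 0) (η := m.restrict Q) (by
      rw [Measure.map_smul, h0]; exact hle)
    have hfZ : IsFiniteMeasure Z' := isFiniteMeasure_of_le _ hZ'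
    have hacZ : Z' ≪ Z := (absolutelyContinuous_of_le hZ').trans smul_absolutelyContinuous
    have hle1 : Z'.map (eval 0) ≤ (1 : ℝ≥0∞) • m := by rw [eZ, one_smul]; exact restrict_le_self
    have hcd : CDineq K N m Z' := cd_of_opt hCD hGT (hb.mono hacZ) (ho.mono_smul hb hk0 hkt hZ')
      (by rw [eZ]; exact absolutelyContinuous_of_le restrict_le_self)
      ((hacZ.map (measurable_eval 1)).trans h1)
    refine ⟨Z', hacZ, fun s S hS hz => ?_⟩
    have hTm : MeasurableSet (cthickening (s * D1) Q) := isClosed_cthickening.measurableSet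
    have hT : (Z'.map (eval s)) (cthickening (s * D1) Q)ᶜ = 0 := by
      rw [map_apply (measurable_eval s) hTm.compl]
      have hin : ∀ᵐ γ ∂Z', eval 0 γ ∈ Q := by
        rw [← ae_map_iff (p := fun x => x ∈ Q) (measurable_eval 0).aemeasurable hQm, eZ]
        exact ae_restrict_mem hQm
      have : ∀ᵐ γ ∂Z', eval s γ ∈ cthickening (s * D1) Q := by
        filter_upwards [hin, hacZ.ae_le hDZ] with γ hγ hl
        apply mem_cthickening_of_dist_le _ _ _ _ hγ
        rw [dist_eval]
        simp only [Set.Icc.coe_zero, sub_zero, abs_of_nonneg s.2.1]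
        exact mul_le_mul_of_nonneg_left hl s.2.1
      exact this
    have hmass : Z' univ = m Q := by
      have := congrArg (fun μ => μ univ) eZ
      simpa [map_apply (measurable_eval 0) MeasurableSet.univ] using this
    have := hcd.core one_ne_zero ENNReal.one_ne_top hle1 (n := N + 1) (by linarith) hn
      (hacZ.ae_le hDZ) (t := s) (hTm.inter hS.compl) (by
        rw [compl_inter, compl_compl]
        exact measure_union_null hT hz)
    rwa [hmass, one_mul] at this
  obtain ⟨A', hA', hA''⟩ := sub A inferInstance hbA hoA hA1 rfl
    (hDA.mono fun γ h => h.trans (le_max_left _ _))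
  obtain ⟨B', hB', hB''⟩ := sub B inferInstance hbB hoB hB1 heq.symm
    (hDB.mono fun γ h => h.trans (le_max_right _ _))
  have key : ∀ s : ℝ, s ∈ Ioc 0 v →
      2 * (m Q * ENNReal.ofReal (sigLow K (N + 1) (1 - s) D1) ^ (N + 1)) ≤ m (cthickening (s * D1) Q) := by
    intro s hs
    set s' : unitInterval := ⟨s, hs.1.le, by linarith [hs.2]⟩ with hs'
    obtain ⟨S, hS, z1, z2⟩ := (hcon s' hs.1 hs.2).mono_ac (hA'.map (measurable_eval s'))
      (hB'.map (measurable_eval s'))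
    have i1 := hA'' s' S hS z1
    have i2 := hB'' s' Sᶜ hS.compl z2
    rw [compl_compl] at i2
    rw [two_mul]
    refine (add_le_add i1 i2).trans (le_of_eq ?_)
    rw [add_comm]
    exact measure_inter_add_diff _ hS
  have lim1 : Tendsto (fun s : ℝ => 2 * (m Q * ENNReal.ofReal (sigLow K (N + 1) (1 - s) D1) ^ (N + 1)))
      (𝓝[>] 0) (𝓝 (2 * (m Q * 1))) := by
    have t0 : Tendsto (fun h : ℝ => 1 - h) (𝓝[>] 0) (𝓝 1) := by
      have : Tendsto (fun h : ℝ => 1 - h) (𝓝[>] 0) (𝓝 (1 - 0)) :=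
        (Continuous.tendsto (by fun_prop) 0).mono_left nhdsWithin_le_nhds
      simpa using this
    have h2 := sigLow_tendsto (K := K) (D := D1) hn.le hD10.le tendsto_const_nhds t0
    rw [sigLow_one hn.le hD10.le] at h2
    have h3 := ((ENNReal.continuous_rpow_const (y := N + 1)).tendsto _).comp
      ((ENNReal.continuous_ofReal.tendsto _).comp h2)
    rw [ENNReal.ofReal_one, ENNReal.one_rpow] at h3
    exact ENNReal.Tendsto.const_mul (ENNReal.Tendsto.const_mul h3 (Or.inr hQt))
      (Or.inr ENNReal.ofNat_ne_top)
  have lim2 : Tendsto (fun s : ℝ => m (cthickening (s * D1) Q)) (𝓝[>] 0) (𝓝 (m Q)) := by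
    have h1 := tendsto_measure_cthickening_of_isCompact (μ := m) hQ
    have h2 : Tendsto (fun s : ℝ => s * D1) (𝓝[>] 0) (𝓝 0) := by
      have : Tendsto (fun s : ℝ => s * D1) (𝓝[>] 0) (𝓝 (0 * D1)) :=
        (Continuous.tendsto (by fun_prop) 0).mono_left nhdsWithin_le_nhds
      simpa using this
    exact h1.comp h2
  have hfinal := le_of_tendsto_of_tendsto lim1 lim2 (by
    filter_upwards [Ioc_mem_nhdsGT hv] with s hs
    exact key s hs)
  rw [mul_one, two_mul] at hfinal
  have : m Q < m Q + m Q := ENNReal.lt_add_right hQt hQ0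
  exact absurd hfinal (not_le.2 this)

/-- L7 prime -/
lemma sep_ac [ProperSpace X] [IsFiniteMeasureOnCompacts m] (hN : 1 ≤ N)
    (hm : ∀ s : Set X, Bornology.IsBounded s → m s ≠ ⊤)
    (hCD : IsCDStar K N m) (hGT : GoodTransport m) {A B : Measure (Geo X)}
    [IsFiniteMeasure A] [IsFiniteMeasure B] (hb : Bdd (A + B)) (ho : Opt (A + B))
    {C : ℝ≥0∞} (hC0 : C ≠ 0) (hC : C ≠ ⊤) (hle : A.map (eval 0) ≤ C • m)
    (hA1 : A.map (eval 1) ≪ m) (hB1 : B.map (eval 1) ≪ m)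
    (heq : A.map (eval 0) = B.map (eval 0)) (hne : A ≠ 0)
    {f : X → ℝ} (hf : LipschitzWith 1 f) {a δ : ℝ} (hδ : 0 < δ)
    (hfA : ∀ᵐ γ ∂A, f (eval 1 γ) ≤ a) (hfB : ∀ᵐ γ ∂B, a + δ ≤ f (eval 1 γ)) : False := by
  have hAle : A ≤ A + B := Measure.le_add_right le_rfl
  have hBle : B ≤ A + B := Measure.le_add_left le_rfl
  have hAac := absolutelyContinuous_of_le hAle
  have hBac := absolutelyContinuous_of_le hBle
  obtain ⟨D, hD0, hD⟩ := hb.len_le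
  have hac : ∀ t, (A + B).map (eval t) ≪ m := by
    apply lemmaA_ac hN hCD hGT hb ho (C := C + C) (by simp [hC0]) (by simp [hC])
    · rw [Measure.map_add _ _ (measurable_eval 0), ← heq, add_smul]
      exact add_le_add hle hle
    · rw [Measure.map_add _ _ (measurable_eval 1)]
      exact hA1.add_left hB1
  set w := min (1 / 2) (δ / (4 * D)) with hw
  have hw0 : 0 < w := lt_min (by norm_num) (by positivity)
  have hw2 : w ≤ 1 / 2 := min_le_left _ _
  have hwD : w * D ≤ δ / 4 := by
    calc w * D ≤ δ / (4 * D) * D := by gcongr; exact min_le_right _ _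
      _ = δ / 4 := by field_simp
  obtain ⟨s, hs0, hsv, hov⟩ := start_overlap hN hCD hGT (hb.mono hAac) (hb.mono hBac)
    (ho.mono hb hAle) (ho.mono hb hBle)
    ((absolutelyContinuous_of_le hle).trans smul_absolutelyContinuous) hA1 hB1 heq hne
    (v := 1 - w) (by linarith) (by linarith)
  obtain ⟨c, hcv, hov'⟩ := nb_prop hN hm hCD hGT hb ho hac hs0 hov (v := 1 - w) (by linarith) hsv
  apply hov'
  have hdist : ∀ γ : Geo X, len γ ≤ D → |f (eval c γ) - f (eval 1 γ)| ≤ δ / 4 := by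
    intro γ hγ
    have h1 := hf.dist_le_mul (eval c γ) (eval 1 γ)
    rw [dist_eval, Real.dist_eq] at h1
    simp only [NNReal.coe_one, one_mul, Set.Icc.coe_one] at h1
    have h2 : |(c : ℝ) - 1| ≤ w := by
      rw [abs_le]; constructor <;> linarith [c.2.2]
    have h3 : |(c : ℝ) - 1| * len γ ≤ w * D := mul_le_mul h2 hγ (len_nonneg γ) hw0.le
    linarith
  have hSm : MeasurableSet {x | a + δ / 2 ≤ f x} := measurableSet_le measurable_const hf.continuous.measurable
  refine ⟨{x | a + δ / 2 ≤ f x}, hSm, ?_, ?_⟩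
  · rw [map_apply (measurable_eval c) hSm]
    have : ∀ᵐ γ ∂A, ¬ (a + δ / 2 ≤ f (eval c γ)) := by
      filter_upwards [hfA, hAac.ae_le hD] with γ h1 h2
      have := abs_le.1 (hdist γ h2)
      linarith [this.1, this.2]
    rw [ae_iff] at this
    simpa using this
  · rw [map_apply (measurable_eval c) hSm.compl]
    have : ∀ᵐ γ ∂B, a + δ / 2 ≤ f (eval c γ) := by
      filter_upwards [hfB, hBac.ae_le hD] with γ h1 h2
      have := abs_le.1 (hdist γ h2)
      linarith [this.1, this.2]
    exact this

end Sep


section Sep2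

open Measure

variable [BorelSpace X] {K N : ℝ} {m : Measure X} [SigmaFinite m]

lemma ball_transfer {α β : Measure (Geo X)} {x0 : X} {R : ℝ}
    (h : ∀ᵐ γ ∂α, dist (eval 0 γ) x0 ≤ R ∧ dist (eval 1 γ) x0 ≤ R)
    (h0 : β.map (eval 0) ≪ α.map (eval 0)) (h1 : β.map (eval 1) ≪ α.map (eval 1)) :
    ∀ᵐ γ ∂β, dist (eval 0 γ) x0 ≤ R ∧ dist (eval 1 γ) x0 ≤ R := by
  rw [Filter.eventually_and] at h ⊢
  have hm : MeasurableSet {x : X | dist x x0 ≤ R} := measurableSet_closedBall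
  exact ⟨(ae_map_iff (measurable_eval 0).aemeasurable hm).1
      (h0.ae_le ((ae_map_iff (measurable_eval 0).aemeasurable hm).2 h.1)),
    (ae_map_iff (measurable_eval 1).aemeasurable hm).1
      (h1.ae_le ((ae_map_iff (measurable_eval 1).aemeasurable hm).2 h.2))⟩

lemma good_part (hN : 1 ≤ N) (hCD : IsCDStar K N m) {α : Measure (Geo X)} [IsFiniteMeasure α]
    (hb : Bdd α) {C : ℝ≥0∞} (hC0 : C ≠ 0) (hC : C ≠ ⊤) (hle : α.map (eval 0) ≤ C • m)
    (hne : α ≠ 0) {r : unitInterval} (hr : (r : ℝ) < 1) :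
    ∃ α' ξ : Measure (Geo X), IsFiniteMeasure α' ∧ α'.map (eval 0) = α.map (eval 0) ∧
      α'.map (eval 1) = α.map (eval 1) ∧ Opt α' ∧ ξ ≤ α' ∧ ξ ≠ 0 ∧ ξ.map (eval r) ≤ m := by
  obtain ⟨α', hf, e0, e1, ho, hcd⟩ := exists_cd hCD hb
  have hne' : α' ≠ 0 := by
    intro h
    apply hne
    rw [← Measure.measure_univ_eq_zero, ← univ_of_map e0, h]; simp
  have hns := hcd.not_sing hN hC0 hC (by rw [e0]; exact hle) (hb.congr e0 e1) hne' hr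
  have hη := inf_ne_zero hns
  obtain ⟨ξ, hξ, eξ⟩ := exists_lift α' (measurable_eval r) (η := α'.map (eval r) ⊓ m) inf_le_left
  refine ⟨α', ξ, hf, e0, e1, ho, hξ, ?_, ?_⟩
  · rintro rfl
    apply hη; rw [← eξ]; simp
  · rw [eξ]; exact inf_le_right

/-- L7 -/
lemma sep [ProperSpace X] [IsFiniteMeasureOnCompacts m] (hN : 1 ≤ N)
    (hm : ∀ s : Set X, Bornology.IsBounded s → m s ≠ ⊤)
    (hCD : IsCDStar K N m) (hGT : GoodTransport m) {A B : Measure (Geo X)}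
    [IsFiniteMeasure A] [IsFiniteMeasure B] (hb : Bdd (A + B)) (ho : Opt (A + B))
    {C : ℝ≥0∞} (hC0 : C ≠ 0) (hC : C ≠ ⊤) (hle : A.map (eval 0) ≤ C • m)
    (heq : A.map (eval 0) = B.map (eval 0)) (hne : A ≠ 0)
    {f : X → ℝ} (hf : LipschitzWith 1 f) {a δ : ℝ} (hδ : 0 < δ)
    (hfA : ∀ᵐ γ ∂A, f (eval 1 γ) ≤ a) (hfB : ∀ᵐ γ ∂B, a + δ ≤ f (eval 1 γ)) : False := by
  have hAle : A ≤ A + B := Measure.le_add_right le_rfl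
  have hBle : B ≤ A + B := Measure.le_add_left le_rfl
  have hAac := absolutelyContinuous_of_le hAle
  have hBac := absolutelyContinuous_of_le hBle
  obtain ⟨x0, R, hR, hball⟩ := hb
  have hb : Bdd (A + B) := ⟨x0, R, hR, hball⟩
  set D := 2 * R + 1 with hD
  have hD0 : 0 < D := by linarith
  have hlen : ∀ γ : Geo X, dist (eval 0 γ) x0 ≤ R ∧ dist (eval 1 γ) x0 ≤ R → len γ ≤ D := by
    intro γ hγ
    have := dist_triangle_right (eval 0 γ) (eval 1 γ) x0
    unfold len; linarith [hγ.1, hγ.2]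
  set w := min (1 / 2) (δ / (4 * D)) with hw
  have hw0 : 0 < w := lt_min (by norm_num) (by positivity)
  have hw2 : w ≤ 1 / 2 := min_le_left _ _
  have hwD : w * D ≤ δ / 4 := by
    calc w * D ≤ δ / (4 * D) * D := by gcongr; exact min_le_right _ _
      _ = δ / 4 := by field_simp
  set r : unitInterval := ⟨1 - w, by linarith, by linarith⟩ with hrdef
  have hr : (r : ℝ) < 1 := by show 1 - w < 1; linarith
  have hr0 : ((0 : unitInterval) : ℝ) < r := by show (0 : ℝ) < 1 - w; linarith
  have hdist : ∀ γ : Geo X, len γ ≤ D → |f (eval r γ) - f (eval 1 γ)| ≤ δ / 4 := by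
    intro γ hγ
    have h1 := hf.dist_le_mul (eval r γ) (eval 1 γ)
    rw [dist_eval, Real.dist_eq] at h1
    simp only [NNReal.coe_one, one_mul, Set.Icc.coe_one] at h1
    have h2 : |(r : ℝ) - 1| ≤ w := by
      show |1 - w - 1| ≤ w
      rw [abs_le]; constructor <;> linarith
    have h3 : |(r : ℝ) - 1| * len γ ≤ w * D := mul_le_mul h2 hγ (len_nonneg γ) hw0.le
    linarith
  have hbA := hb.mono hAac
  have hbB := hb.mono hBac
  -- first replacement
  obtain ⟨A', ξ, hfA', eA0, eA1, hoA', hξ, hξ0, hξm⟩ := good_part hN hCD hbA hC0 hC hle hne hr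
  have ho1 : Opt (A' + B) := ho.replace hoA' eA0 eA1
  have hbA' : Bdd A' := hbA.congr eA0 eA1
  have hfξ : IsFiniteMeasure ξ := isFiniteMeasure_of_le _ hξ
  obtain ⟨B1, hB1, eB1⟩ := exists_lift B (measurable_eval 0) (η := ξ.map (eval 0)) (by
    rw [← heq, ← eA0]; exact map_le_map hξ 0)
  have hfB1 : IsFiniteMeasure B1 := isFiniteMeasure_of_le _ hB1
  have ho2 : Opt (ξ + B1) := ho1.mono (hbA'.add hbB) (add_le_add hξ hB1)
  have hleξ : ξ.map (eval 0) ≤ C • m := (map_le_map hξ 0).trans (by rw [eA0]; exact hle)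
  have hB10 : B1 ≠ 0 := by
    intro h
    apply hξ0
    rw [← Measure.measure_univ_eq_zero, ← univ_of_map eB1, h]; simp
  have hbB1 : Bdd B1 := hbB.mono (absolutelyContinuous_of_le hB1)
  have hbξ : Bdd ξ := hbA'.mono (absolutelyContinuous_of_le hξ)
  obtain ⟨B', ζ, hfB', eB0', eB1', hoB', hζ, hζ0, hζm⟩ := good_part hN hCD hbB1 hC0 hC
    (by rw [eB1]; exact hleξ) hB10 hr
  have hfζ : IsFiniteMeasure ζ := isFiniteMeasure_of_le _ hζ
  rw [add_comm] at ho2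
  have ho3 : Opt (B' + ξ) := ho2.replace hoB' eB0' eB1'
  rw [add_comm] at ho3
  have hbB' : Bdd B' := hbB1.congr eB0' eB1'
  obtain ⟨ξ', hξ', eξ'⟩ := exists_lift ξ (measurable_eval 0) (η := ζ.map (eval 0)) (by
    rw [← eB1, ← eB0']; exact map_le_map hζ 0)
  have hfξ' : IsFiniteMeasure ξ' := isFiniteMeasure_of_le _ hξ'
  have ho4 : Opt (ξ' + ζ) := ho3.mono (hbξ.add hbB') (add_le_add hξ' hζ)
  have hbξ' : Bdd ξ' := hbξ.mono (absolutelyContinuous_of_le hξ')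
  have hbζ : Bdd ζ := hbB'.mono (absolutelyContinuous_of_le hζ)
  have hξ'0 : ξ' ≠ 0 := by
    intro h
    apply hζ0
    rw [← Measure.measure_univ_eq_zero, ← univ_of_map eξ', h]; simp
  -- ae information
  have hac1 : ∀ t, ξ'.map (eval t) ≪ A'.map (eval t) := fun t =>
    absolutelyContinuous_of_le (map_le_map (hξ'.trans hξ) t)
  have hac2 : ∀ t, ζ.map (eval t) ≪ B'.map (eval t) := fun t =>
    absolutelyContinuous_of_le (map_le_map hζ t)
  have hac3 : ∀ t, B1.map (eval t) ≪ B.map (eval t) := fun t =>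
    absolutelyContinuous_of_le (map_le_map hB1 t)
  have hξA0 : ξ'.map (eval 0) ≪ A.map (eval 0) := by rw [← eA0]; exact hac1 0
  have hξA1 : ξ'.map (eval 1) ≪ A.map (eval 1) := by rw [← eA1]; exact hac1 1
  have hζB0 : ζ.map (eval 0) ≪ B.map (eval 0) := by
    refine (hac2 0).trans ?_; rw [eB0']; exact hac3 0
  have hζB1 : ζ.map (eval 1) ≪ B.map (eval 1) := by
    refine (hac2 1).trans ?_; rw [eB1']; exact hac3 1
  have l1 := ball_transfer (hAac.ae_le hball) hξA0 hξA1
  have l2 := ball_transfer (hBac.ae_le hball) hζB0 hζB1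
  have f1 : ∀ᵐ γ ∂ξ', f (eval 1 γ) ≤ a := by
    have hS : MeasurableSet {x | f x ≤ a} := measurableSet_le hf.continuous.measurable measurable_const
    exact (ae_map_iff (measurable_eval 1).aemeasurable hS).1
      (hξA1.ae_le ((ae_map_iff (measurable_eval 1).aemeasurable hS).2 hfA))
  have f2 : ∀ᵐ γ ∂ζ, a + δ ≤ f (eval 1 γ) := by
    have hS : MeasurableSet {x | a + δ ≤ f x} := measurableSet_le measurable_const hf.continuous.measurable
    exact (ae_map_iff (measurable_eval 1).aemeasurable hS).1
      (hζB1.ae_le ((ae_map_iff (measurable_eval 1).aemeasurable hS).2 hfB))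
  have ho5 := ho4.restr hCD (hbξ'.add hbζ) hr0
  have hb5 := (hbξ'.add hbζ).rest 0 r
  rw [Measure.map_add _ _ (measurable_rest 0 r)] at ho5 hb5
  have hmξ : ξ'.map (eval r) ≤ m := (map_le_map hξ' r).trans hξm
  refine sep_ac hN hm hCD hGT hb5 ho5 hC0 hC ?_ ?_ ?_ ?_ ?_ hf (a := a + δ / 4) (δ := δ / 2)
    (by linarith) ?_ ?_
  · rw [map_rest_zero]; exact (map_le_map hξ' 0).trans hleξ
  · rw [map_rest_one]; exact absolutelyContinuous_of_le hmξ
  · rw [map_rest_one]; exact absolutelyContinuous_of_le hζm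
  · rw [map_rest_zero, map_rest_zero, eξ']
  · rwa [Ne, Measure.map_eq_zero_iff (measurable_rest 0 r).aemeasurable]
  · have hS : MeasurableSet {γ : Geo X | f (eval 1 γ) ≤ a + δ / 4} :=
      measurableSet_le (hf.continuous.measurable.comp (measurable_eval 1)) measurable_const
    refine (ae_map_iff (measurable_rest 0 r).aemeasurable hS).2 ?_
    filter_upwards [l1, f1] with γ h1 h2
    show f (eval 1 (rest 0 r γ)) ≤ a + δ / 4
    rw [eval_rest_one]
    have := abs_le.1 (hdist γ (hlen γ h1))
    linarith [this.1, this.2]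
  · have hS : MeasurableSet {γ : Geo X | a + δ / 4 + δ / 2 ≤ f (eval 1 γ)} :=
      measurableSet_le measurable_const (hf.continuous.measurable.comp (measurable_eval 1))
    refine (ae_map_iff (measurable_rest 0 r).aemeasurable hS).2 ?_
    filter_upwards [l2, f2] with γ h1 h2
    show a + δ / 4 + δ / 2 ≤ f (eval 1 (rest 0 r γ))
    rw [eval_rest_one]
    have := abs_le.1 (hdist γ (hlen γ h1))
    linarith [this.1, this.2]

/-- L8 -/
lemma interp_ac [ProperSpace X] [IsFiniteMeasureOnCompacts m] (hN : 1 ≤ N)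
    (hm : ∀ s : Set X, Bornology.IsBounded s → m s ≠ ⊤)
    (hCD : IsCDStar K N m) (hGT : GoodTransport m) {α : Measure (Geo X)}
    [IsFiniteMeasure α] (hb : Bdd α) (ho : Opt α)
    {C : ℝ≥0∞} (hC0 : C ≠ 0) (hC : C ≠ ⊤) (hle : α.map (eval 0) ≤ C • m)
    {r : unitInterval} (hr0 : 0 < (r : ℝ)) (hr : (r : ℝ) < 1) : α.map (eval r) ≪ m := by
  refine AbsolutelyContinuous.mk fun E0 hE0 hz => ?_
  by_contra hpos
  have hpos' : 0 < (α.map (eval r)) E0 := pos_iff_ne_zero.2 hpos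
  obtain ⟨E, hEE, hEc, hE1⟩ := MeasurableSet.exists_lt_isClosed_of_ne_top hE0 (measure_ne_top _ _) hpos'
  have hEm : MeasurableSet E := hEc.measurableSet
  have hmE : m E = 0 := measure_mono_null hEE hz
  rw [map_apply (measurable_eval r) hEm] at hE1
  set α1 := α.restrict (eval r ⁻¹' E) with hα1
  have hα1le : α1 ≤ α := restrict_le_self
  have hα10 : α1 ≠ 0 := by
    rw [Ne, ← Measure.measure_univ_eq_zero, hα1, Measure.restrict_apply_univ]; exact hE1.ne'
  have hEne : E.Nonempty := by
    rw [nonempty_iff_ne_empty]; rintro rfl; simp at hE1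
  have hb1 : Bdd α1 := hb.mono (absolutelyContinuous_of_le hα1le)
  have ho1 : Opt α1 := ho.mono hb hα1le
  have hle1 := (map_le_map hα1le 0).trans hle
  obtain ⟨β, η, hfβ, e0, e1, hoβ, hη, hη0, hηm⟩ := good_part hN hCD hb1 hC0 hC hle1 hα10 hr
  have ho2 : Opt (α1 + α1) := by
    have := ho1.smul (c := 2) two_ne_zero ENNReal.ofNat_ne_top
    rwa [two_smul] at this
  have ho3 : Opt (β + α1) := ho2.replace hoβ e0 e1
  rw [add_comm] at ho3
  have hbβ : Bdd β := hb1.congr e0 e1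
  have hfη : IsFiniteMeasure η := isFiniteMeasure_of_le _ hη
  set g : Geo X → ℝ := fun γ => infDist (eval r γ) E with hg
  have hgm : Measurable g := (continuous_infDist_pt E).measurable.comp (measurable_eval r)
  have hgpos : ∀ᵐ γ ∂η, 0 < g γ := by
    have h1 : ∀ᵐ γ ∂η, eval r γ ∉ E := by
      have : (η.map (eval r)) E = 0 := le_antisymm ((hηm E).trans hmE.le) bot_le
      rw [map_apply (measurable_eval r) hEm] at this
      rw [ae_iff]; simp only [not_not]; exact this
    filter_upwards [h1] with γ h
    exact (hEc.notMem_iff_infDist_pos hEne).1 h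
  obtain ⟨k, hk⟩ : ∃ k : ℕ, η {γ | 1 / ((k : ℝ) + 1) ≤ g γ} ≠ 0 := by
    by_contra hcon
    push Not at hcon
    apply hη0
    rw [← Measure.measure_univ_eq_zero]
    have : ∀ᵐ γ ∂η, ∀ k : ℕ, ¬ 1 / ((k : ℝ) + 1) ≤ g γ := by
      rw [ae_all_iff]; intro k; rw [ae_iff]; simpa using hcon k
    have hF : ∀ᵐ γ ∂η, False := by
      filter_upwards [this, hgpos] with γ h1 h2
      obtain ⟨k, hk⟩ := exists_nat_one_div_lt h2
      exact h1 k hk.le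
    simpa [ae_iff] using hF
  set δ : ℝ := 1 / ((k : ℝ) + 1) with hδ
  have hδ0 : 0 < δ := by positivity
  have hSm : MeasurableSet {γ | δ ≤ g γ} := measurableSet_le measurable_const hgm
  set ζ := η.restrict {γ | δ ≤ g γ} with hζ
  have hζle : ζ ≤ β := restrict_le_self.trans hη
  have hζ0 : ζ ≠ 0 := by
    rw [Ne, ← Measure.measure_univ_eq_zero, hζ, Measure.restrict_apply_univ]; exact hk
  obtain ⟨α', hα', eα'⟩ := exists_lift α1 (measurable_eval 0) (η := ζ.map (eval 0)) (by
    rw [← e0]; exact map_le_map hζle 0)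
  have hfα' : IsFiniteMeasure α' := isFiniteMeasure_of_le _ hα'
  have hα'0 : α' ≠ 0 := by
    intro h
    apply hζ0
    rw [← Measure.measure_univ_eq_zero, ← univ_of_map eα', h]; simp
  have ho4 : Opt (α' + ζ) := ho3.mono (hb1.add hbβ) (add_le_add hα' hζle)
  have hb4 : Bdd (α' + ζ) := (hb1.mono (absolutelyContinuous_of_le hα')).add
    (hbβ.mono (absolutelyContinuous_of_le hζle))
  have ho5 := ho4.restr hCD hb4 (a := 0) (c := r) hr0
  have hb5 := hb4.rest 0 r
  rw [Measure.map_add _ _ (measurable_rest 0 r)] at ho5 hb5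
  refine sep hN hm hCD hGT hb5 ho5 hC0 hC ?_ ?_ ?_ (lipschitz_infDist_pt E) (a := 0) hδ0 ?_ ?_
  · rw [map_rest_zero]; exact (map_le_map hα' 0).trans hle1
  · rw [map_rest_zero, map_rest_zero, eα']
  · rwa [Ne, Measure.map_eq_zero_iff (measurable_rest 0 r).aemeasurable]
  · have hS : MeasurableSet {γ : Geo X | infDist (eval 1 γ) E ≤ 0} :=
      measurableSet_le ((continuous_infDist_pt E).measurable.comp (measurable_eval 1)) measurable_const
    refine (ae_map_iff (measurable_rest 0 r).aemeasurable hS).2 ?_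
    have : ∀ᵐ γ ∂α1, eval r γ ∈ E := ae_restrict_mem (measurable_eval r hEm)
    filter_upwards [(absolutelyContinuous_of_le hα').ae_le this] with γ h
    show infDist (eval 1 (rest 0 r γ)) E ≤ 0
    rw [eval_rest_one, infDist_zero_of_mem h]
  · have hS : MeasurableSet {γ : Geo X | 0 + δ ≤ infDist (eval 1 γ) E} :=
      measurableSet_le measurable_const ((continuous_infDist_pt E).measurable.comp (measurable_eval 1))
    refine (ae_map_iff (measurable_rest 0 r).aemeasurable hS).2 ?_
    have : ∀ᵐ γ ∂ζ, δ ≤ g γ := ae_restrict_mem hSm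
    filter_upwards [this] with γ h
    show 0 + δ ≤ infDist (eval 1 (rest 0 r γ)) E
    rw [eval_rest_one, zero_add]; exact h

end Sep2


/-- **Corollary 1.6, bounded supports**: if `μ ≤ C·m` and `μ,ν` have bounded supports then the
interpolants have density bounded by `C(t) = C · sup_{0 ≤ θ ≤ D} σ_{K,N}^{(1-t)}(θ)^{-N}`,
a finite constant. -/
theorem interpolant_density_bound
    [CompleteSpace X] [TopologicalSpace.SeparableSpace X] [ProperSpace X] [BorelSpace X]
    (hX : IsGeodesicSpace X) (m : Measure X)
    (hm_bdd : ∀ s : Set X, Bornology.IsBounded s → m s ≠ ⊤)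
    (hm_supp : ∀ x : X, ∀ r : ℝ, 0 < r → 0 < m (ball x r))
    (K N : ℝ) (hN : 1 ≤ N) (hCD : IsCDStar K N m) (hGT : GoodTransport m)
    (μ ν : Measure X) (hμp : IsProbabilityMeasure μ) (hνp : IsProbabilityMeasure ν)
    (hμ2 : HasFiniteSecondMoment μ) (hν2 : HasFiniteSecondMoment ν)
    (hμsupp : Bornology.IsBounded (measSupport μ))
    (hνsupp : Bornology.IsBounded (measSupport ν))
    (C : ℝ) (hC : 0 < C) (hμC : μ ≤ ENNReal.ofReal C • m)
    (π : Measure (Geo X)) (hπ : IsOptGeo μ ν π) :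
    ∀ t : unitInterval, (t : ℝ) < 1 →
      (⨆ θ ∈ Icc (0 : ℝ) (Metric.diam (measSupport μ ∪ measSupport ν)),
          sigmaCoeff K N (1 - (t : ℝ)) θ ^ (-N)) ≠ ⊤ ∧
      π.map (eval t) ≤
        (ENNReal.ofReal C *
          ⨆ θ ∈ Icc (0 : ℝ) (Metric.diam (measSupport μ ∪ measSupport ν)),
            sigmaCoeff K N (1 - (t : ℝ)) θ ^ (-N)) • m := by
  have hsc : SecondCountableTopology X := inferInstance
  have hfc : IsFiniteMeasureOnCompacts m := ⟨fun {s} hs => (hm_bdd s hs.isBounded).lt_top⟩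
  have hsf : SigmaFinite m := inferInstance
  have full : ∀ η : Measure X, ∀ᵐ x ∂η, x ∈ measSupport η := by
    intro η
    rw [ae_iff]
    refine measure_null_of_locally_null _ fun x hx => ?_
    have hx' : ¬ ∀ U ∈ nhds x, 0 < η U := hx
    push Not at hx'
    obtain ⟨U, hU, h0⟩ := hx'
    exact ⟨U, mem_nhdsWithin_of_mem_nhds hU, le_antisymm h0 bot_le⟩
  have hopt : Opt π := hπ.opt
  obtain ⟨hπp, e0, e1, -⟩ := hπ
  set S := measSupport μ ∪ measSupport ν with hS
  have hSb : Bornology.IsBounded S := hμsupp.union hνsupp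
  set D := Metric.diam S with hD
  have hD0 : 0 ≤ D := Metric.diam_nonneg
  have hin : ∀ᵐ γ ∂π, eval 0 γ ∈ S ∧ eval 1 γ ∈ S := by
    have h0 : ∀ᵐ γ ∂π, eval 0 γ ∈ measSupport μ :=
      ae_of_ae_map (measurable_eval 0).aemeasurable (by rw [e0]; exact full μ)
    have h1 : ∀ᵐ γ ∂π, eval 1 γ ∈ measSupport ν :=
      ae_of_ae_map (measurable_eval 1).aemeasurable (by rw [e1]; exact full ν)
    filter_upwards [h0, h1] with γ a b
    exact ⟨Or.inl a, Or.inr b⟩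
  have hlen : ∀ᵐ γ ∂π, len γ ≤ D := by
    filter_upwards [hin] with γ h
    exact Metric.dist_le_diam_of_mem hSb h.1 h.2
  have hb : Bdd π := by
    obtain ⟨γ0, h0⟩ := hin.exists
    refine ⟨eval 0 γ0, D, hD0, ?_⟩
    filter_upwards [hin] with γ h
    exact ⟨Metric.dist_le_diam_of_mem hSb h.1 h0.1, Metric.dist_le_diam_of_mem hSb h.2 h0.1⟩
  have hC0 : ENNReal.ofReal C ≠ 0 := (ENNReal.ofReal_pos.2 hC).ne'
  have hCt : ENNReal.ofReal C ≠ ⊤ := ENNReal.ofReal_ne_top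
  intro t ht
  have ht0 : (0 : ℝ) ≤ t := t.2.1
  set s := sigLow K N (1 - (t : ℝ)) D with hs
  have hs0 : 0 < s := sigLow_pos hN (by linarith) hD0
  have hsN0 : ENNReal.ofReal s ^ N ≠ 0 := by
    rw [Ne, ENNReal.rpow_eq_zero_iff_of_pos (by linarith)]
    exact (ENNReal.ofReal_pos.2 hs0).ne'
  have hsNt : ENNReal.ofReal s ^ N ≠ ⊤ :=
    ENNReal.rpow_ne_top_of_nonneg (by linarith) ENNReal.ofReal_ne_top
  constructor
  · refine ne_top_of_le_ne_top (ENNReal.inv_ne_top.2 hsN0) (iSup₂_le fun θ hθ => ?_)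
    rw [ENNReal.rpow_neg, ENNReal.inv_le_inv]
    exact ENNReal.rpow_le_rpow
      (sigLow_le hN (by linarith) (by linarith) hθ.1 hθ.2) (by linarith)
  rw [Measure.le_iff]
  intro E hE
  have key : (π.map (eval t)) E * ENNReal.ofReal s ^ N ≤ ENNReal.ofReal C * m E := by
    have hfin : (π.map (eval t)) E ≠ ⊤ := by
      rw [Measure.map_apply (measurable_eval t) hE]; exact measure_ne_top _ _
    have lf : Filter.Tendsto (fun h : ℝ => N + h) (nhdsWithin 0 (Ioi 0)) (nhds N) := by
      have : Filter.Tendsto (fun h : ℝ => N + h) (nhdsWithin 0 (Ioi 0)) (nhds (N + 0)) :=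
        (Continuous.tendsto (by fun_prop) 0).mono_left nhdsWithin_le_nhds
      simpa using this
    have lg : Filter.Tendsto (fun h : ℝ => 1 - (t : ℝ) / (1 - h)) (nhdsWithin 0 (Ioi 0))
        (nhds (1 - (t : ℝ))) := by
      have : Filter.Tendsto (fun h : ℝ => 1 - (t : ℝ) / (1 - h)) (nhdsWithin 0 (Ioi 0))
          (nhds (1 - (t : ℝ) / (1 - 0))) := by
        refine (ContinuousAt.tendsto ?_).mono_left nhdsWithin_le_nhds
        fun_prop (disch := norm_num)
      simpa using this
    have ls := sigLow_tendsto (K := K) (D := D) hN hD0 lf lg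
    have lr := ls.rpow lf (Or.inl hs0.ne')
    have le := ENNReal.Tendsto.const_mul (a := (π.map (eval t)) E) (ENNReal.tendsto_ofReal lr)
      (Or.inr hfin)
    rw [← ENNReal.ofReal_rpow_of_pos hs0] at le
    refine le_of_tendsto le ?_
    filter_upwards [self_mem_nhdsWithin, Ioo_mem_nhdsGT (show (0 : ℝ) < 1 - t by linarith)] with h hh0 hh
    have hh0' : 0 < h := hh0
    have hr1 : (0 : ℝ) < 1 - h := by linarith [hh.2]
    set r : unitInterval := ⟨1 - h, by linarith, by linarith⟩ with hr
    have hrc : (r : ℝ) = 1 - h := rfl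
    set u : unitInterval := ⟨(t : ℝ) / (1 - h), by positivity, by
      rw [div_le_one hr1]; linarith [hh.2]⟩ with hu
    have huc : (u : ℝ) = (t : ℝ) / (1 - h) := rfl
    have haff : affI 0 r u = t := by
      apply Subtype.ext
      rw [affI_coe, hrc, huc]
      simp only [Set.Icc.coe_zero, mul_zero, zero_add]
      field_simp
    have hpos : 0 < sigLow K (N + h) (1 - (t : ℝ) / (1 - h)) D := by
      refine sigLow_pos (by linarith) ?_ hD0
      rw [sub_pos, div_lt_one hr1]; linarith [hh.2]
    have hac := interp_ac hN hm_bdd hCD hGT hb hopt hC0 hCt (by rw [e0]; exact hμC)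
      (r := r) (by rw [hrc]; exact hr1) (by rw [hrc]; linarith)
    have hor := hopt.restr hCD hb (a := 0) (c := r) (by rw [hrc]; simpa using hr1)
    have hlen' : ∀ᵐ γ ∂(π.map (rest 0 r)), len γ ≤ D := by
      refine (ae_map_iff (measurable_rest 0 r).aemeasurable
        (measurableSet_le measurable_len measurable_const)).2 ?_
      filter_upwards [hlen] with γ hγ
      rw [len_rest]
      have h1 : |((0 : unitInterval) : ℝ) - r| ≤ 1 := by
        rw [Set.Icc.coe_zero, zero_sub, abs_neg, abs_of_nonneg r.2.1]; exact r.2.2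
      calc _ ≤ 1 * len γ := mul_le_mul_of_nonneg_right h1 (len_nonneg γ)
        _ ≤ D := by rw [one_mul]; exact hγ
    have := lemmaA hCD hGT (hb.rest 0 r) hor hC0 hCt
      (by rw [map_rest_zero, e0]; exact hμC) (by rw [map_rest_one]; exact hac)
      (n := N + h) (by linarith) (by linarith) hlen' u hE
    rw [map_rest_eval, haff, huc] at this
    rwa [ENNReal.ofReal_rpow_of_pos hpos] at this
  rw [Measure.smul_apply, smul_eq_mul]
  have hsup : (ENNReal.ofReal s ^ N)⁻¹ ≤ ⨆ θ ∈ Icc (0 : ℝ) D, sigmaCoeff K N (1 - (t : ℝ)) θ ^ (-N) := by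
    rw [← ENNReal.rpow_neg, hs, sigLow_eq hN]
    refine le_iSup₂_of_le (if 0 ≤ K then 0 else D) ?_ le_rfl
    split_ifs
    · exact ⟨le_rfl, hD0⟩
    · exact ⟨hD0, le_rfl⟩
  calc (π.map (eval t)) E = (π.map (eval t)) E * ENNReal.ofReal s ^ N * (ENNReal.ofReal s ^ N)⁻¹ := by
        rw [mul_assoc, ENNReal.mul_inv_cancel hsN0 hsNt, mul_one]
    _ ≤ (ENNReal.ofReal C * m E) * ⨆ θ ∈ Icc (0 : ℝ) D, sigmaCoeff K N (1 - (t : ℝ)) θ ^ (-N) :=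
        mul_le_mul' key hsup
    _ = _ := by ring

end
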